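/- For every integer r ≥ 1, as N → ∞ one has M̄_r^+(N) ~ γ_r · N^{r/2 − 1} · e^{π√N}, where γ_r = r! · η(r) · π^{−r} · 2^{r−3} (so for r ≥ 2, γ_r = r! ζ(r)(1 − 2^{1−r}) π^{−r} 2^{r−3}); that is, M̄_r^+(N) / (γ_r N^{r/2−1} e^{π√N}) → 1 as N → ∞. -/

import Mathlib

open scoped BigOperators
open Filter MeasureTheory

/-- An overpartition of `n`: a partition of `n` in which the first occurrence of
each part size may be overlined.  We encode it as a finite set of (distinct)
overlined parts together with a multiset of non-overlined parts, all positive,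
with total sum `n`. -/
structure Overpartition (n : ℕ) where
  overlined : Finset ℕ
  nonoverlined : Multiset ℕ
  overlined_pos : ∀ i ∈ overlined, 0 < i
  nonoverlined_pos : ∀ i ∈ nonoverlined, 0 < i
  total : (overlined.sum id) + nonoverlined.sum = n

namespace Overpartition

/-- The multiset of all parts of an overpartition. -/
def parts {n : ℕ} (p : Overpartition n) : Multiset ℕ := p.overlined.val + p.nonoverlined

/-- Dyson's rank of an overpartition: largest part minus number of parts. -/
def rank {n : ℕ} (p : Overpartition n) : ℤ :=
  (p.parts.sup : ℤ) - (Multiset.card p.parts : ℤ)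

end Overpartition

/-- The crank of a partition (given as a multiset of positive parts):
the largest part if there are no 1's, and otherwise `μ(λ) - o(λ)` where `o(λ)`
is the number of 1's and `μ(λ)` is the number of parts larger than `o(λ)`. -/
def multisetCrank (s : Multiset ℕ) : ℤ :=
  if s.count 1 = 0 then (s.sup : ℤ)
  else ((s.filter (fun part => s.count 1 < part)).card : ℤ) - (s.count 1 : ℤ)

/-- The first residual crank of an overpartition: the crank of the subpartition
consisting of the non-overlined parts. -/
def Overpartition.crank {n : ℕ} (p : Overpartition n) : ℤ := multisetCrank p.nonoverlined

/-- `Mbar m n` is the number of overpartitions of `n` with first residual crank `m`. -/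
noncomputable def Mbar (m : ℤ) (n : ℕ) : ℕ :=
  Nat.card {p : Overpartition n // p.crank = m}

/-- `Nbar m n` is the number of overpartitions of `n` with Dyson rank `m`. -/
noncomputable def Nbar (m : ℤ) (n : ℕ) : ℕ :=
  Nat.card {p : Overpartition n // p.rank = m}

/-- The `r`-th positive crank moment `M̄_r^+(N) = Σ_{m ≥ 1} m^r M̄(m,N)`. -/
noncomputable def Mplus (r N : ℕ) : ℝ :=
  ∑' m : ℕ, ((m : ℝ) + 1) ^ r * (Mbar ((m : ℤ) + 1) N : ℝ)

/-- The `r`-th positive rank moment `N̄_r^+(N) = Σ_{m ≥ 1} m^r N̄(m,N)`. -/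
noncomputable def Nplus (r N : ℕ) : ℝ :=
  ∑' m : ℕ, ((m : ℝ) + 1) ^ r * (Nbar ((m : ℤ) + 1) N : ℝ)

/-- Positive symmetrized crank moment `μ̄_r^+(n) = Σ_{m ≥ 1} C(m + ⌊(r-1)/2⌋, r) M̄(m,n)`. -/
noncomputable def mubar (r n : ℕ) : ℝ :=
  ∑' m : ℕ, (Nat.choose (m + 1 + (r - 1) / 2) r : ℝ) * (Mbar ((m : ℤ) + 1) n : ℝ)

/-- Positive symmetrized rank moment `η̄_r^+(n) = Σ_{m ≥ 1} C(m + ⌊(r-1)/2⌋, r) N̄(m,n)`. -/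
noncomputable def etabar (r n : ℕ) : ℝ :=
  ∑' m : ℕ, (Nat.choose (m + 1 + (r - 1) / 2) r : ℝ) * (Nbar ((m : ℤ) + 1) n : ℝ)

/-- The Dirichlet eta function at positive integers:
`η(1) = log 2` and `η(r) = (1 - 2^{1-r}) ζ(r)` for `r ≥ 2`. -/
noncomputable def dirichletEtaNat (r : ℕ) : ℝ :=
  if r = 1 then Real.log 2 else (1 - 2 ^ (1 - (r : ℝ))) * (riemannZeta r).re

/-- The infinite Pochhammer symbol `(a; q)_∞ = Π_{j ≥ 0} (1 - a q^j)`. -/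
noncomputable def poch (a q : ℂ) : ℂ := ∏' j : ℕ, (1 - a * q ^ j)

/-- The (integral) exponent `n²/2 + (r/2 + ρ_C(r)) n`, where `ρ_C(r) = 0` for odd `r`
and `1/2` for even `r`. -/
def eC (r n : ℕ) : ℕ := (n * n + r * n + (if r % 2 = 0 then n else 0)) / 2

/-- The (integral) exponent `n² + (r/2 + ρ_R(r)) n`, where `ρ_R(r) = 1/2` for odd `r`
and `1` for even `r`. -/
def eR (r n : ℕ) : ℕ := (2 * n * n + r * n + (if r % 2 = 1 then n else 2 * n)) / 2

/-- `S_r(q) = Σ_{n ≥ 1} (-1)^{n+1} q^{n²/2 + (r/2 + ρ_C(r)) n} / (1 - q^n)^r`. -/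
noncomputable def Sr (r : ℕ) (q : ℂ) : ℂ :=
  ∑' n : ℕ, (-1 : ℂ) ^ n * q ^ eC r (n + 1) / (1 - q ^ (n + 1)) ^ r

/-- `S̃_r(q) = Σ_{n ≥ 1} (-1)^{n+1} q^{n² + (r/2 + ρ_R(r)) n} / ((1 - q^n)^r (1 + q^n))`. -/
noncomputable def Str (r : ℕ) (q : ℂ) : ℂ :=
  ∑' n : ℕ, (-1 : ℂ) ^ n * q ^ eR r (n + 1) / ((1 - q ^ (n + 1)) ^ r * (1 + q ^ (n + 1)))

/-- `SC_r(q) = ((-q;q)_∞/(q;q)_∞) S_r(q)`, the generating function of the positive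
symmetrized crank moments. -/
noncomputable def SCr (r : ℕ) (q : ℂ) : ℂ := (poch (-q) q / poch q q) * Sr r q

/-- `SR_r(q) = 2 ((-q;q)_∞/(q;q)_∞) S̃_r(q)`, the generating function of the positive
symmetrized rank moments. -/
noncomputable def SRr (r : ℕ) (q : ℂ) : ℂ := 2 * (poch (-q) q / poch q q) * Str r q

/-- `c_r = ζ(r) (1 - 2^{1-r})`. -/
noncomputable def cconst (r : ℕ) : ℂ := riemannZeta r * (1 - 2 ^ (1 - (r : ℂ)))

/-- `d_r = -(ζ(r-2)(1-2^{3-r})/2 + ρ_C(r) ζ(r-1)(1-2^{1-r}))`. -/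
noncomputable def dconst (r : ℕ) : ℂ :=
  -(riemannZeta ((r : ℂ) - 2) * (1 - 2 ^ (3 - (r : ℂ))) / 2 +
    (if r % 2 = 0 then (1 : ℂ) / 2 else 0) * riemannZeta ((r : ℂ) - 1) * (1 - 2 ^ (1 - (r : ℂ))))

/-- `d'_r = -(ζ(r-2)(1-2^{3-r}) + (ρ_R(r)/2) ζ(r-1)(1-2^{1-r}))`. -/
noncomputable def dconst' (r : ℕ) : ℂ :=
  -(riemannZeta ((r : ℂ) - 2) * (1 - 2 ^ (3 - (r : ℂ))) +
    (if r % 2 = 1 then (1 : ℂ) / 4 else (1 : ℂ) / 2) * riemannZeta ((r : ℂ) - 1) *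
      (1 - 2 ^ (1 - (r : ℂ))))

/-- The modified Bessel function of the first kind,
`I_s(x) = Σ_{k ≥ 0} (x/2)^{2k+s} / (k! Γ(k+s+1))`. -/
noncomputable def besselI (s x : ℝ) : ℝ :=
  ∑' k : ℕ, (x / 2) ^ (2 * (k : ℝ) + s) / ((k.factorial : ℝ) * Real.Gamma ((k : ℝ) + s + 1))

/-- The point `τ = x + i y` in the upper half plane. -/
noncomputable def mkTau (x y : ℝ) : ℂ := (x : ℂ) + (y : ℂ) * Complex.I

namespace CrankProof
open scoped ENNReal

/-- `1/(q;q)_k` as an extended nonnegative real. -/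
noncomputable def ff (q : ℝ≥0∞) (k : ℕ) : ℝ≥0∞ := ∏ i ∈ Finset.range k, (1 - q ^ (i + 1))⁻¹

lemma geo_one (r : ℝ≥0∞) : (1 - r)⁻¹ = 1 + r * (1 - r)⁻¹ := by
  rw [← ENNReal.tsum_geometric, ← ENNReal.tsum_mul_left,
    tsum_eq_zero_add' ENNReal.summable]
  simp [pow_succ']

lemma geo_split (r : ℝ≥0∞) (d : ℕ) :
    (1 - r)⁻¹ = ∑ o ∈ Finset.range d, r ^ o + r ^ d * (1 - r)⁻¹ := by
  induction d with
  | zero => simp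
  | succ d ih =>
    rw [Finset.sum_range_succ, add_assoc, pow_succ, mul_assoc]
    conv_lhs => rw [ih]
    conv_lhs => rw [geo_one r]
    ring

lemma ff_zero (q : ℝ≥0∞) : ff q 0 = 1 := by simp [ff]

lemma ff_succ (q : ℝ≥0∞) (k : ℕ) : ff q (k + 1) = ff q k * (1 - q ^ (k + 1))⁻¹ := by
  simp [ff, Finset.prod_range_succ]

lemma ff_succ' (q : ℝ≥0∞) (k : ℕ) : ff q (k + 1) = ff q k + q ^ (k + 1) * ff q (k + 1) := by
  rw [ff_succ]
  conv_lhs => rw [geo_one]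
  ring

lemma pow_lt_one' {q : ℝ≥0∞} (hq : q < 1) (k : ℕ) : q ^ (k + 1) < 1 :=
  pow_lt_one₀ (by simp) hq (by simp)

lemma inv_ne_top {q : ℝ≥0∞} (hq : q < 1) : (1 - q)⁻¹ ≠ ⊤ := by
  rw [ENNReal.inv_ne_top]; exact (tsub_pos_of_lt hq).ne'

lemma inv_ne_zero' {q : ℝ≥0∞} : (1 - q)⁻¹ ≠ 0 := by
  rw [ENNReal.inv_ne_zero]; exact ne_top_of_le_ne_top ENNReal.one_ne_top tsub_le_self

lemma ff_ne_top {q : ℝ≥0∞} (hq : q < 1) (k : ℕ) : ff q k ≠ ⊤ := by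
  apply ENNReal.prod_ne_top
  intro i _
  exact inv_ne_top (pow_lt_one' hq i)

lemma ff_mono (q : ℝ≥0∞) : Monotone (ff q) := by
  apply monotone_nat_of_le_succ
  intro n
  rw [ff_succ']; exact le_self_add

lemma sum_ff (q : ℝ≥0∞) (m : ℕ) : ∑ k ∈ Finset.range (m + 1), q ^ k * ff q k = ff q m := by
  induction m with
  | zero => simp
  | succ m ih => rw [Finset.sum_range_succ, ih]; exact (ff_succ' q m).symm

/-- tail sums `∑_{k ≥ K} q^{a k} / (q;q)_k`. -/
noncomputable def SS (q : ℝ≥0∞) (a K : ℕ) : ℝ≥0∞ := ∑' j : ℕ, q ^ (a * (K + j)) * ff q (K + j)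

lemma SS_zero (q : ℝ≥0∞) (a K : ℕ) : SS q a K = q ^ (a * K) * ff q K + SS q a (K + 1) := by
  unfold SS
  rw [tsum_eq_zero_add' ENNReal.summable]
  simp only [add_zero]
  congr 2
  ext j
  rw [show K + (j + 1) = K + 1 + j by ring]

lemma SS_split (q : ℝ≥0∞) (m : ℕ) : SS q 1 0 = ff q m + SS q 1 (m + 1) := by
  induction m with
  | zero => rw [SS_zero]; simp
  | succ m ih =>
    rw [ih, SS_zero q 1 (m + 1)]
    conv_rhs => rw [ff_succ']
    ring

/-- The total generating function is finite. -/
lemma SS_rec {q : ℝ≥0∞} (a K : ℕ) :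
    SS q a K = q ^ (a * K) * ff q K + (q ^ a * SS q a K + SS q (a + 1) (K + 1)) := by
  conv_lhs => rw [SS_zero]
  congr 1
  unfold SS
  rw [← ENNReal.tsum_mul_left, ← ENNReal.tsum_add]
  congr 1
  ext j
  rw [show K + 1 + j = (K + j) + 1 by ring]
  conv_lhs => rw [ff_succ']
  ring

lemma SS_le {q : ℝ≥0∞} (hq : q ≤ 1) {a b K : ℕ} (h : a ≤ b) : SS q b K ≤ SS q a K := by
  unfold SS
  apply ENNReal.tsum_le_tsum
  intro j
  gcongr ?_ * _
  exact pow_le_pow_of_le_one (by simp) hq (by gcongr)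

lemma SS_anti (q : ℝ≥0∞) (a : ℕ) {K L : ℕ} (h : K ≤ L) : SS q a L ≤ SS q a K := by
  induction L, h using Nat.le_induction with
  | base => rfl
  | succ L _ ih => refine le_trans ?_ ih; rw [SS_zero q a L]; exact le_add_self

lemma EE_rec {q : ℝ≥0∞} (hq : q < 1) (hP : SS q 1 0 ≠ ⊤) (m o : ℕ) :
    ff q o * SS q (o + 1) (m + o) = q ^ ((o + 1) * (m + o)) * ff q (o + 1) * ff q (m + o)
      + ff q (o + 1) * SS q (o + 2) (m + (o + 1)) := by
  have h := SS_rec (q := q) (o + 1) (m + o)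
  have hf : ff q (o + 1) * (q ^ (o + 1) * SS q (o + 1) (m + o)) ≠ ⊤ := by
    apply ENNReal.mul_ne_top (ff_ne_top hq _)
    apply ENNReal.mul_ne_top (pow_lt_one' hq _).ne_top
    refine ne_top_of_le_ne_top hP ((SS_le hq.le (by lia)).trans (SS_anti q 1 (by lia)))
  rw [← ENNReal.add_left_inj hf]
  have h2 := congrArg (ff q (o + 1) * ·) h
  calc _ = (ff q o + q ^ (o + 1) * ff q (o + 1)) * SS q (o + 1) (m + o) := by ring
    _ = ff q (o + 1) * SS q (o + 1) (m + o) := by rw [← ff_succ']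
    _ = _ := h2
    _ = _ := by rw [show m + (o + 1) = m + o + 1 by ring]; ring

lemma SS_tendsto {q : ℝ≥0∞} (hP : SS q 1 0 ≠ ⊤) :
    Filter.Tendsto (fun o => SS q 1 o) Filter.atTop (nhds 0) := by
  have : ∀ o, SS q 1 o = ∑' k, (fun j => q ^ (1 * j) * ff q j) (k + o) := by
    intro o; unfold SS; congr 1; ext k; simp [add_comm]
  simp_rw [this]
  apply ENNReal.tendsto_sum_nat_add (fun j => q ^ (1 * j) * ff q j)
  simpa [SS] using hP

lemma ff_le_SS (q : ℝ≥0∞) (m : ℕ) : ff q m ≤ SS q 1 0 := by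
  rw [SS_split q m]; exact le_self_add

lemma EE_sum {q : ℝ≥0∞} (hq : q < 1) (hP : SS q 1 0 ≠ ⊤) (m o : ℕ) :
    ff q o * SS q (o + 1) (m + o) =
      ∑' j : ℕ, q ^ ((o + j + 1) * (m + (o + j))) * ff q (o + j + 1) * ff q (m + (o + j)) := by
  symm
  have key : ∀ n, ff q o * SS q (o + 1) (m + o) = (∑ j ∈ Finset.range n,
      q ^ ((o + j + 1) * (m + (o + j))) * ff q (o + j + 1) * ff q (m + (o + j)))
      + ff q (o + n) * SS q (o + n + 1) (m + (o + n)) := by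
    intro n
    induction n with
    | zero => simp
    | succ n ih =>
      rw [ih, Finset.sum_range_succ, EE_rec hq hP, ← add_assoc]
      rfl
  have ht : Filter.Tendsto (fun n => ff q (o + n) * SS q (o + n + 1) (m + (o + n)))
      Filter.atTop (nhds 0) := by
    have h0 : Filter.Tendsto (fun n => SS q 1 0 * SS q 1 n) Filter.atTop (nhds 0) := by
      have := ENNReal.Tendsto.const_mul (a := SS q 1 0) (SS_tendsto hP) (Or.inr hP)
      simpa using this
    refine tendsto_of_tendsto_of_tendsto_of_le_of_le tendsto_const_nhds h0 (fun _ => by simp) ?_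
    intro n
    dsimp only
    gcongr ?_ * ?_
    · exact ff_le_SS q _
    · exact (SS_le hq.le (by lia)).trans (SS_anti q 1 (by lia))
  have hs := ENNReal.tendsto_nat_tsum (fun j =>
    q ^ ((o + j + 1) * (m + (o + j))) * ff q (o + j + 1) * ff q (m + (o + j)))
  have := hs.add ht
  simp_rw [← key, add_zero] at this
  exact tendsto_nhds_unique this tendsto_const_nhds

lemma antidiag (q : ℝ≥0∞) (D : ℕ → ℝ≥0∞) :
    ∑' o, q ^ o * ∑' j, D (o + j) = ∑' d, (∑ o ∈ Finset.range (d + 1), q ^ o) * D d := by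
  simp_rw [← ENNReal.tsum_mul_left]
  rw [← ENNReal.tsum_prod (f := fun o j => q ^ o * D (o + j))]
  rw [← (Finset.HasAntidiagonal.sigmaAntidiagonalEquivProd (A := ℕ)).tsum_eq, ENNReal.tsum_sigma']
  congr 1
  ext d
  rw [tsum_fintype, Finset.sum_mul, ← Finset.Nat.sum_antidiagonal_eq_sum_range_succ (fun o _ => q ^ o * D d)]
  rw [← Finset.sum_coe_sort (Finset.HasAntidiagonal.antidiagonal d)]
  apply Finset.sum_congr rfl
  intro x _
  have := x.2
  rw [Finset.HasAntidiagonal.mem_antidiagonal] at this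
  simp [this]

lemma geo_ff {q : ℝ≥0∞} (hq : q < 1) (d : ℕ) :
    (∑ o ∈ Finset.range (d + 1), q ^ o) * ff q (d + 1) = (1 - q)⁻¹ * ff q d := by
  have h1 := geo_split q (d + 1)
  set A := ∑ o ∈ Finset.range (d + 1), q ^ o
  set I := (1 - q)⁻¹
  have hf : q ^ (d + 1) * (I * ff q (d + 1)) ≠ ⊤ :=
    ENNReal.mul_ne_top (pow_lt_one' hq _).ne_top
      (ENNReal.mul_ne_top (inv_ne_top hq) (ff_ne_top hq _))
  rw [← ENNReal.add_left_inj hf]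
  calc _ = (A + q ^ (d + 1) * I) * ff q (d + 1) := by ring
    _ = I * ff q (d + 1) := by rw [← h1]
    _ = I * (ff q d + q ^ (d + 1) * ff q (d + 1)) := by rw [← ff_succ']
    _ = _ := by ring

/-- generating function for crank at least `m`. -/
noncomputable def RR (q : ℝ≥0∞) (m : ℕ) : ℝ≥0∞ :=
  ∑' d : ℕ, q ^ ((d + 1) * (m + d)) * ff q d * ff q (m + d)

lemma YY {q : ℝ≥0∞} (hq : q < 1) (hP : SS q 1 0 ≠ ⊤) (m : ℕ) :
    ∑' o, q ^ o * (ff q o * SS q (o + 1) (m + o)) = (1 - q)⁻¹ * RR q m := by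
  simp_rw [EE_sum hq hP]
  rw [antidiag q (fun d => q ^ ((d + 1) * (m + d)) * ff q (d + 1) * ff q (m + d))]
  rw [RR, ← ENNReal.tsum_mul_left]
  congr 1
  ext d
  calc _ = q ^ ((d + 1) * (m + d)) * ff q (m + d) *
      ((∑ o ∈ Finset.range (d + 1), q ^ o) * ff q (d + 1)) := by ring
    _ = _ := by rw [geo_ff hq]; ring

lemma RR_rec {q : ℝ≥0∞} (hq : q < 1) (hP : SS q 1 0 ≠ ⊤) (m : ℕ) :
    RR q m + q ^ m * RR q (m + 1) = q ^ m * SS q 1 0 := by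
  have h1 := EE_sum hq hP (m + 1) 0
  simp only [ff_zero, one_mul, zero_add, add_zero] at h1
  rw [SS_split q m, h1]
  have h2 : RR q m = q ^ m * ∑' d : ℕ, q ^ (d * (m + d) + d) * ff q d * ff q (m + d) := by
    rw [RR, ← ENNReal.tsum_mul_left]; congr 1; ext d; ring
  rw [h2, ← mul_add]
  congr 1
  rw [tsum_eq_zero_add' ENNReal.summable]
  simp only [zero_mul, pow_zero, ff_zero, one_mul, add_zero]
  rw [add_assoc]
  congr 1
  rw [RR, ← ENNReal.tsum_add]
  congr 1
  ext d
  conv_rhs => rw [ff_succ']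
  rw [show m + (d + 1) = m + 1 + d by ring]
  ring

end CrankProof

namespace CrankProof
open scoped ENNReal

/-- weighted count of a set of multisets. -/
noncomputable def WW (q : ℝ≥0∞) (S : Set (Multiset ℕ)) : ℝ≥0∞ := ∑' s : S, q ^ (s.1.sum)

lemma WW_union (q : ℝ≥0∞) {S T : Set (Multiset ℕ)} (h : Disjoint S T) :
    WW q (S ∪ T) = WW q S + WW q T :=
  Summable.tsum_union_disjoint (f := fun s : Multiset ℕ => q ^ s.sum) h ENNReal.summable
    ENNReal.summable

lemma WW_iUnion (q : ℝ≥0∞) {S : ℕ → Set (Multiset ℕ)} (h : Pairwise (Function.onFun Disjoint S)) :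
    WW q (⋃ i, S i) = ∑' i, WW q (S i) := by
  unfold WW
  rw [← (Set.unionEqSigmaOfDisjoint h).symm.tsum_eq, ENNReal.tsum_sigma']
  rfl

lemma WW_singleton (q : ℝ≥0∞) (s : Multiset ℕ) : WW q {s} = q ^ s.sum := by
  unfold WW
  rw [tsum_singleton s (fun s : Multiset ℕ => q ^ s.sum)]

lemma WW_split (q : ℝ≥0∞) (p : ℕ → Prop) [DecidablePred p] (S T U : Set (Multiset ℕ))
    (hS : ∀ s ∈ S, ∀ x ∈ s, p x) (hT : ∀ s ∈ T, ∀ x ∈ s, ¬ p x)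
    (hU : ∀ s, s ∈ U ↔ s.filter p ∈ S ∧ s.filter (fun x => ¬ p x) ∈ T) :
    WW q U = WW q S * WW q T := by
  unfold WW
  rw [← ENNReal.tsum_mul_right]
  simp_rw [← ENNReal.tsum_mul_left]
  rw [← ENNReal.tsum_prod (f := fun (s : S) (t : T) => q ^ s.1.sum * q ^ t.1.sum)]
  let e : U ≃ S × T :=
    { toFun := fun u => (⟨_, ((hU u.1).1 u.2).1⟩, ⟨_, ((hU u.1).1 u.2).2⟩)
      invFun := fun st => ⟨st.1.1 + st.2.1, by
        rw [hU]
        rw [Multiset.filter_add, Multiset.filter_add,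
          Multiset.filter_eq_self.2 (hS _ st.1.2), Multiset.filter_eq_nil.2 (hT _ st.2.2),
          Multiset.filter_eq_self.2 (hT _ st.2.2), Multiset.filter_eq_nil.2]
        · simp
        · intro a ha; simpa using hS _ st.1.2 a ha⟩
      left_inv := fun u => by
        ext1
        exact Multiset.filter_add_not p u.1
      right_inv := fun st => by
        ext1 <;> ext1 <;> dsimp only
        · rw [Multiset.filter_add, Multiset.filter_eq_self.2 (hS _ st.1.2),
            Multiset.filter_eq_nil.2 (hT _ st.2.2)]; simp
        · rw [Multiset.filter_add, Multiset.filter_eq_self.2 (hT _ st.2.2),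
            Multiset.filter_eq_nil.2]
          · simp
          · intro a ha; simpa using hS _ st.1.2 a ha }
  rw [← e.tsum_eq]
  congr 1
  ext u
  rw [← pow_add]
  congr 1
  rw [← Multiset.sum_add]
  exact congrArg _ (Multiset.filter_add_not p u.1).symm

/-- copies of one part -/
lemma WW_repl (q : ℝ≥0∞) (i : ℕ) (hi : 0 < i) : WW q {s | ∀ x ∈ s, x = i} = (1 - q ^ i)⁻¹ := by
  rw [← ENNReal.tsum_geometric]
  unfold WW
  let e : {s : Multiset ℕ | ∀ x ∈ s, x = i} ≃ ℕ :=
    { toFun := fun s => s.1.card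
      invFun := fun n => ⟨Multiset.replicate n i, fun x hx => Multiset.eq_of_mem_replicate hx⟩
      left_inv := fun s => by ext1; exact (Multiset.eq_replicate.2 ⟨rfl, s.2⟩).symm
      right_inv := fun n => by simp }
  rw [← e.tsum_eq]
  congr 1
  ext s
  have := Multiset.eq_replicate.2 ⟨rfl, s.2⟩
  rw [← pow_mul]
  congr 1
  conv_lhs => rw [this]
  simp [e, mul_comm]

lemma WW_parts (q : ℝ≥0∞) (T : Finset ℕ) (hT : ∀ i ∈ T, 0 < i) :
    WW q {s | ∀ x ∈ s, x ∈ T} = ∏ i ∈ T, (1 - q ^ i)⁻¹ := by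
  induction T using Finset.induction_on with
  | empty =>
    have : {s : Multiset ℕ | ∀ x ∈ s, x ∈ (∅ : Finset ℕ)} = {0} := by
      ext s; simp [Multiset.eq_zero_iff_forall_notMem]
    rw [this, WW_singleton]; simp
  | insert i T hi ih =>
    rw [Finset.prod_insert hi, ← ih (fun j hj => hT j (by simp [hj])),
      ← WW_repl q i (hT i (by simp))]
    apply WW_split q (fun x => x = i)
    · intro s hs x hx; exact hs x hx
    · intro s hs x hx h; subst h; exact hi (hs _ hx)
    · intro s
      simp only [Set.mem_ofPred_eq, Multiset.mem_filter, Finset.mem_insert]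
      constructor
      · intro h
        refine ⟨fun x hx => hx.2, fun x hx => (h x hx.1).resolve_left hx.2⟩
      · rintro ⟨-, h⟩ x hx
        by_cases hxi : x = i
        · exact Or.inl hxi
        · exact Or.inr (h x ⟨hx, hxi⟩)

/-- multisets of naturals of given cardinality -/
lemma WW_card_ne_top {q : ℝ≥0∞} (hq : q < 1) (k : ℕ) : WW q {s | s.card = k} ≠ ⊤ := by
  induction k with
  | zero =>
    have : {s : Multiset ℕ | s.card = 0} = {0} := by ext s; simp
    rw [this, WW_singleton]; simp
  | succ k ih =>
    let f : ℕ × {s : Multiset ℕ | s.card = k} → {s : Multiset ℕ | s.card = k + 1} :=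
      fun x => ⟨x.1 ::ₘ x.2.1, by have := x.2.2; simp only [Set.mem_ofPred_eq] at this; simp [this]⟩
    have hf : Function.Surjective f := by
      rintro ⟨s, hs⟩
      have hs' : s.card = k + 1 := hs
      obtain ⟨a, ha⟩ := Multiset.card_pos_iff_exists_mem.1 (show 0 < s.card by lia)
      obtain ⟨t, rfl⟩ := Multiset.exists_cons_of_mem ha
      rw [Multiset.card_cons] at hs'
      refine ⟨⟨a, ⟨t, Nat.succ_injective hs'⟩⟩, rfl⟩
    have h1 := ENNReal.tsum_le_tsum_comp_of_surjective hf (fun s => q ^ s.1.sum)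
    refine ne_top_of_le_ne_top ?_ h1
    have : ∀ x : ℕ × {s : Multiset ℕ | s.card = k}, q ^ (f x).1.sum =
        (fun a (s : {s : Multiset ℕ | s.card = k}) => q ^ a * q ^ s.1.sum) x.1 x.2 := by
      intro x; simp [f, pow_add]
    simp_rw [this]
    rw [ENNReal.tsum_prod (f := fun a (s : {s : Multiset ℕ | s.card = k}) => q ^ a * q ^ s.1.sum)]
    simp_rw [ENNReal.tsum_mul_left]
    rw [ENNReal.tsum_mul_right, ENNReal.tsum_geometric]
    exact ENNReal.mul_ne_top (inv_ne_top hq) ih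

lemma WW_shift (q : ℝ≥0∞) (a k : ℕ) :
    WW q {s | (∀ x ∈ s, a ≤ x) ∧ s.card = k} = q ^ (a * k) * WW q {s | s.card = k} := by
  unfold WW
  rw [← ENNReal.tsum_mul_left]
  let e : {s : Multiset ℕ | (∀ x ∈ s, a ≤ x) ∧ s.card = k} ≃ {s : Multiset ℕ | s.card = k} :=
    { toFun := fun s => ⟨s.1.map (· - a), by simpa using s.2.2⟩
      invFun := fun s => ⟨s.1.map (· + a), by simp, by rw [Multiset.card_map]; exact s.2⟩
      left_inv := fun s => by
        ext1
        dsimp only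
        rw [Multiset.map_map]
        conv_rhs => rw [← Multiset.map_id s.1]
        apply Multiset.map_congr rfl
        intro x hx
        have := s.2.1 x hx
        simp; lia
      right_inv := fun s => by
        ext1
        simp [Multiset.map_map] }
  rw [← e.symm.tsum_eq]
  congr 1
  ext s
  rw [← pow_add]
  congr 1
  have := s.2
  simp only [Set.mem_ofPred_eq] at this
  simp [e, Multiset.sum_map_add, this]
  ring

lemma WW_card {q : ℝ≥0∞} (hq : q < 1) (k : ℕ) : WW q {s | s.card = k} = ff q k := by
  induction k with
  | zero =>
    have : {s : Multiset ℕ | s.card = 0} = {0} := by ext s; simp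
    rw [this, WW_singleton]; simp [ff_zero]
  | succ k ih =>
    have h1 : WW q {s | s.card = k + 1} = ff q k + q ^ (k + 1) * WW q {s | s.card = k + 1} := by
      have hu : {s : Multiset ℕ | s.card = k + 1} =
          {s | 0 ∈ s ∧ s.card = k + 1} ∪ {s | (∀ x ∈ s, 1 ≤ x) ∧ s.card = k + 1} := by
        ext s
        simp only [Set.mem_ofPred_eq, Set.mem_union]
        constructor
        · intro h
          by_cases h0 : 0 ∈ s
          · exact Or.inl ⟨h0, h⟩
          · refine Or.inr ⟨fun x hx => ?_, h⟩
            by_contra h2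
            have : x = 0 := by lia
            exact h0 (this ▸ hx)
        · rintro (h | h) <;> exact h.2
      conv_lhs => rw [hu]
      rw [WW_union, WW_shift, one_mul, ← ih]
      · congr 1
        unfold WW
        let e : {s : Multiset ℕ | 0 ∈ s ∧ s.card = k + 1} ≃ {s : Multiset ℕ | s.card = k} :=
          { toFun := fun s => ⟨s.1.erase 0, by
              have := s.2; simp [Multiset.card_erase_of_mem s.2.1, s.2.2]⟩
            invFun := fun s => ⟨0 ::ₘ s.1, by simp, by rw [Multiset.card_cons]; exact congrArg (· + 1) s.2⟩
            left_inv := fun s => by ext1; exact Multiset.cons_erase s.2.1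
            right_inv := fun s => by ext1; simp }
        rw [← e.symm.tsum_eq]
        simp [e]
      · rw [Set.disjoint_left]
        rintro s ⟨h, -⟩ ⟨h2, -⟩
        have := h2 0 h
        lia
    have hfin := WW_card_ne_top hq (k + 1)
    set X := WW q {s | s.card = k + 1}
    -- X = f_k + r X, f_{k+1} = f_k + r f_{k+1}
    have h2 := ff_succ' q k
    have hi := inv_ne_top (pow_lt_one' hq k)
    set r := q ^ (k + 1)
    have h3 := geo_one r
    rw [ff_succ]
    have hr : r ≠ ⊤ := (pow_lt_one' hq k).ne_top
    have hf : r * X * (1 - r)⁻¹ ≠ ⊤ := ENNReal.mul_ne_top (ENNReal.mul_ne_top hr hfin) hi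
    rw [← ENNReal.add_left_inj hf]
    calc _ = X * (1 + r * (1 - r)⁻¹) := by ring
      _ = X * (1 - r)⁻¹ := by rw [← h3]
      _ = (ff q k + r * X) * (1 - r)⁻¹ := by rw [← h1]
      _ = _ := by ring

lemma WW_card_ge {q : ℝ≥0∞} (hq : q < 1) (a K : ℕ) :
    WW q {s | (∀ x ∈ s, a ≤ x) ∧ K ≤ s.card} = SS q a K := by
  have : {s : Multiset ℕ | (∀ x ∈ s, a ≤ x) ∧ K ≤ s.card} =
      ⋃ j : ℕ, {s | (∀ x ∈ s, a ≤ x) ∧ s.card = K + j} := by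
    ext s
    simp only [Set.mem_ofPred_eq, Set.mem_iUnion]
    constructor
    · rintro ⟨h, h2⟩; exact ⟨s.card - K, h, by lia⟩
    · rintro ⟨j, h, h2⟩; exact ⟨h, by lia⟩
  rw [this, WW_iUnion]
  · simp_rw [WW_shift, WW_card hq]; rfl
  · intro i j hij
    simp only [Function.onFun]
    rw [Set.disjoint_left]
    rintro s ⟨-, h⟩ ⟨-, h2⟩
    lia

/-- All partitions. -/
def Pos : Set (Multiset ℕ) := {s | ∀ i ∈ s, 0 < i}

lemma WW_pos {q : ℝ≥0∞} (hq : q < 1) : WW q Pos = SS q 1 0 := by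
  rw [← WW_card_ge hq]; congr 1; ext s; simp [Pos, Nat.one_le_iff_ne_zero, Nat.pos_iff_ne_zero]

/-- Partitions with crank at least `m`. -/
def Cr (m : ℕ) : Set (Multiset ℕ) := {s | (∀ i ∈ s, 0 < i) ∧ (m : ℤ) ≤ multisetCrank s}

lemma ff_Icc (q : ℝ≥0∞) (o : ℕ) (ho : 1 ≤ o) :
    (1 - q)⁻¹ * ∏ i ∈ Finset.Icc 2 o, (1 - q ^ i)⁻¹ = ff q o := by
  induction o, ho using Nat.le_induction with
  | base => simp [ff]
  | succ o ho ih => rw [Finset.prod_Icc_succ_top (by lia), ← mul_assoc, ih, ff_succ]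

/-- crank at least `m` with exactly `o ≥ 1` ones. -/
lemma WW_Cr_ones {q : ℝ≥0∞} (hq : q < 1) (m o : ℕ) (ho : 1 ≤ o) :
    (1 - q)⁻¹ * WW q {s | s ∈ Cr m ∧ s.count 1 = o} =
      q ^ o * (ff q o * SS q (o + 1) (m + o)) := by
  have h1 : WW q {s | s ∈ Cr m ∧ s.count 1 = o} = WW q {Multiset.replicate o 1} *
      WW q {t | (∀ x ∈ t, 2 ≤ x) ∧ m + o ≤ (t.filter (fun x => o < x)).card} := by
    apply WW_split q (fun x => x = 1)
    · intro s hs x hx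
      rw [Set.mem_singleton_iff.1 hs] at hx
      exact Multiset.eq_of_mem_replicate hx
    · intro s hs x hx h
      have := hs.1 x hx
      lia
    · intro s
      simp only [Set.mem_ofPred_eq, Set.mem_singleton_iff, Cr, multisetCrank]
      rw [Multiset.filter_eq', Multiset.filter_filter]
      have e1 : s.filter (fun x => o < x ∧ ¬ x = 1) = s.filter (fun x => o < x) := by
        apply Multiset.filter_congr; intro x _; constructor
        · exact fun h => h.1
        · intro h; exact ⟨h, by lia⟩
      rw [e1]
      constructor
      · rintro ⟨⟨h1, h2⟩, h3⟩
        rw [h3, if_neg (by lia)] at h2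
        refine ⟨by rw [h3], fun x hx => ?_, by lia⟩
        rw [Multiset.mem_filter] at hx
        have := h1 x hx.1
        have := hx.2
        lia
      · rintro ⟨h1, h2, h3⟩
        have h4 : s.count 1 = o := by
          have := congrArg Multiset.card h1
          simpa using this
        rw [h4, if_neg (by lia)]
        refine ⟨⟨fun i hi => ?_, by lia⟩, rfl⟩
        by_cases hi1 : i = 1
        · lia
        · have := h2 i (Multiset.mem_filter.2 ⟨hi, hi1⟩)
          lia
  have h2 : WW q {t | (∀ x ∈ t, 2 ≤ x) ∧ m + o ≤ (t.filter (fun x => o < x)).card} =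
      WW q {s | ∀ x ∈ s, x ∈ Finset.Icc 2 o} *
      WW q {s | (∀ x ∈ s, o + 1 ≤ x) ∧ m + o ≤ s.card} := by
    apply WW_split q (fun x => x ≤ o)
    · intro s hs x hx
      exact (Finset.mem_Icc.1 (hs x hx)).2
    · intro s hs x hx
      have := hs.1 x hx
      lia
    · intro s
      simp only [Set.mem_ofPred_eq, Multiset.mem_filter, Finset.mem_Icc, not_le]
      constructor
      · rintro ⟨h1, h2⟩
        exact ⟨fun x hx => ⟨h1 x hx.1, hx.2⟩, fun x hx => hx.2, h2⟩
      · rintro ⟨h1, h2, h3⟩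
        refine ⟨fun x hx => ?_, h3⟩
        by_cases hxo : x ≤ o
        · exact (h1 x ⟨hx, hxo⟩).1
        · lia
  rw [h1, h2, WW_singleton, WW_parts, WW_card_ge hq, ← ff_Icc q o ho]
  · simp; ring
  · intro i hi; have := (Finset.mem_Icc.1 hi).1; lia

lemma multiset_sup_le (s : Multiset ℕ) (k : ℕ) : s.sup ≤ k ↔ ∀ x ∈ s, x ≤ k := Multiset.sup_le

/-- crank at least `m` with no ones. -/
lemma WW_Cr_zero {q : ℝ≥0∞} (hq : q < 1) (m : ℕ) (hm : 1 ≤ m) :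
    (1 - q)⁻¹ * (WW q {s | s ∈ Cr m ∧ s.count 1 = 0} + if m = 1 then q else 0) =
      SS q 1 m := by
  have h1 : WW q Pos = (1 - q)⁻¹ * WW q {s | ∀ x ∈ s, 2 ≤ x} := by
    have := WW_repl q 1 one_pos
    rw [pow_one] at this
    rw [← this]
    apply WW_split q (fun x => x = 1)
    · intro s hs x hx; exact hs x hx
    · intro s hs x hx h
      have := hs x hx
      lia
    · intro s
      simp only [Set.mem_ofPred_eq, Multiset.mem_filter, Pos]
      constructor
      · intro h; exact ⟨fun x hx => hx.2, fun x hx => by have := h x hx.1; lia⟩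
      · rintro ⟨-, h⟩ x hx
        by_cases hx1 : x = 1
        · lia
        · have := h x ⟨hx, hx1⟩; lia
  have h2 : WW q {s | ∀ x ∈ s, 2 ≤ x} = WW q {s | ∀ x ∈ s, x ∈ Finset.Icc 2 (m - 1)} +
      WW q {s | s ∈ Cr m ∧ s.count 1 = 0} := by
    rw [← WW_union]
    · congr 1
      ext s
      simp only [Set.mem_ofPred_eq, Set.mem_union, Finset.mem_Icc, Cr, multisetCrank]
      constructor
      · intro h
        have hc : s.count 1 = 0 := by
          rw [Multiset.count_eq_zero]; intro h1; have := h 1 h1; lia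
        rw [if_pos hc]
        by_cases hs : s.sup ≤ m - 1
        · left; intro x hx; exact ⟨h x hx, (multiset_sup_le s _).1 hs x hx⟩
        · right; exact ⟨⟨fun i hi => by have := h i hi; lia, by lia⟩, hc⟩
      · rintro (h | ⟨⟨h, -⟩, h2⟩) x hx
        · exact (h x hx).1
        · have := h x hx
          rcases Nat.lt_or_ge x 2 with h3 | h3
          · have : x = 1 := by lia
            subst this
            exact absurd hx (Multiset.count_eq_zero.1 h2)
          · exact h3
    · rw [Set.disjoint_left]
      intro s hs hs2
      simp only [Set.mem_ofPred_eq, Finset.mem_Icc, Cr, multisetCrank] at hs hs2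
      rw [if_pos hs2.2] at hs2
      have : s.sup ≤ m - 1 := (multiset_sup_le s _).2 (fun x hx => (hs x hx).2)
      have := hs2.1.2
      lia
  have hfin : WW q {s | ∀ x ∈ s, x ∈ Finset.Icc 2 (m - 1)} = 
    ∏ i ∈ Finset.Icc 2 (m - 1), (1 - q ^ i)⁻¹ := by
    apply WW_parts
    intro i hi; have := (Finset.mem_Icc.1 hi).1; lia
  rw [WW_pos hq, h2, hfin, SS_split q (m - 1), show m - 1 + 1 = m by lia, mul_add] at h1
  rw [mul_add]
  by_cases h : m = 1
  · subst h
    simp only [if_true]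
    simp only [tsub_self, ff_zero] at h1
    rw [show Finset.Icc 2 0 = (∅ : Finset ℕ) from rfl, Finset.prod_empty, mul_one] at h1
    rw [geo_one q, add_assoc, ENNReal.add_right_inj (by simp), ← geo_one q] at h1
    rw [h1, mul_comm q, add_comm]
  · rw [if_neg h, mul_zero, add_zero]
    rw [ff_Icc q (m - 1) (by lia), ENNReal.add_right_inj (ff_ne_top hq _)] at h1
    exact h1.symm

lemma WW_Cr {q : ℝ≥0∞} (hq : q < 1) (hP : SS q 1 0 ≠ ⊤) (m : ℕ) (hm : 1 ≤ m) :
    WW q (Cr m) + (if m = 1 then q else 0) = RR q m := by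
  have h0 : Cr m = ⋃ o : ℕ, {s | s ∈ Cr m ∧ s.count 1 = o} := by ext s; simp
  have h1 : WW q (Cr m) = ∑' o : ℕ, WW q {s | s ∈ Cr m ∧ s.count 1 = o} := by
    conv_lhs => rw [h0]
    apply WW_iUnion
    intro i j hij
    simp only [Function.onFun]
    rw [Set.disjoint_left]
    rintro s ⟨-, h⟩ ⟨-, h2⟩
    lia
  have h2 := YY hq hP m
  rw [tsum_eq_zero_add' ENNReal.summable] at h2
  simp_rw [← WW_Cr_ones hq m (_ + 1) (Nat.le_add_left 1 _)] at h2
  simp only [pow_zero, one_mul, ff_zero, zero_add, add_zero] at h2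
  rw [← WW_Cr_zero hq m hm, ENNReal.tsum_mul_left, ← mul_add] at h2
  have h3 := (ENNReal.mul_right_inj inv_ne_zero' (inv_ne_top hq)).1 h2
  rw [← h3, h1, tsum_eq_zero_add' ENNReal.summable]
  ring

end CrankProof

namespace CrankProof
open scoped ENNReal

/-- number of overpartitions of `n` whose non-overlined part lies in `S` -/
noncomputable def opc (S : Set (Multiset ℕ)) (n : ℕ) : ℕ :=
  Nat.card {p : Overpartition n // p.nonoverlined ∈ S}

noncomputable def QQ (q : ℝ≥0∞) : ℝ≥0∞ :=
  ∑' T : {T : Finset ℕ // ∀ i ∈ T, 0 < i}, q ^ (T.1.sum id)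

lemma ovp_ext {n : ℕ} {p p' : Overpartition n} (h1 : p.overlined = p'.overlined)
    (h2 : p.nonoverlined = p'.nonoverlined) : p = p' := by
  cases p; cases p'; simp_all

lemma card_le_sum' (s : Multiset ℕ) (h : ∀ i ∈ s, 0 < i) : s.card ≤ s.sum := by
  induction s using Multiset.induction_on with
  | empty => simp
  | cons a s ih =>
    have := h a (by simp)
    have := ih (fun i hi => h i (by simp [hi]))
    simp; lia

instance ovp_finite (n : ℕ) : Finite (Overpartition n) := by
  let A : Set (Finset ℕ) := Set.Icc ∅ (Finset.range (n + 1))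
  let B : Set (Multiset ℕ) := Set.Icc 0 (n • (Multiset.range (n + 1)))
  have hA : Finite A := Set.finite_Icc _ _
  have hB : Finite B := Set.finite_Icc _ _
  have h1 : ∀ p : Overpartition n, p.overlined ∈ A := by
    intro p
    refine ⟨by simp, fun i hi => ?_⟩
    have h2 := Finset.single_le_sum (f := id) (fun i _ => Nat.zero_le _) hi
    have := p.total
    simp only [Finset.mem_range, id] at *
    lia
  have h2 : ∀ p : Overpartition n, p.nonoverlined ∈ B := by
    intro p
    refine ⟨by simp, ?_⟩
    rw [Multiset.le_iff_count]
    intro i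
    by_cases hi : i ∈ p.nonoverlined
    · have h3 : i ≤ p.nonoverlined.sum := Multiset.le_sum_of_mem hi
      have h4 := card_le_sum' _ p.nonoverlined_pos
      have h5 := Multiset.count_le_card i p.nonoverlined
      have := p.total
      rw [Multiset.count_nsmul, Multiset.count_eq_one_of_mem (Multiset.nodup_range _)
        (by rw [Multiset.mem_range]; lia)]
      lia
    · rw [Multiset.count_eq_zero_of_notMem hi]; exact Nat.zero_le _
  refine Finite.of_injective (β := A × B) (fun p => (⟨_, h1 p⟩, ⟨_, h2 p⟩)) ?_
  intro p p' h
  simp only [Prod.mk.injEq, Subtype.mk.injEq] at h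
  exact ovp_ext h.1 h.2

lemma gf (q : ℝ≥0∞) (S : Set (Multiset ℕ)) (hS : S ⊆ Pos) :
    ∑' n, (opc S n : ℝ≥0∞) * q ^ n = QQ q * WW q S := by
  have h1 : ∀ n, (opc S n : ℝ≥0∞) * q ^ n =
      ∑' _p : {p : Overpartition n // p.nonoverlined ∈ S}, q ^ n := by
    intro n
    have := Fintype.ofFinite {p : Overpartition n // p.nonoverlined ∈ S}
    rw [tsum_fintype, Finset.sum_const, opc, Nat.card_eq_fintype_card, nsmul_eq_mul]
    rfl
  simp_rw [h1]
  rw [← ENNReal.tsum_sigma' (f := fun x : (Σ n, {p : Overpartition n // p.nonoverlined ∈ S}) =>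
    q ^ x.1)]
  unfold QQ WW
  rw [← ENNReal.tsum_mul_right]
  simp_rw [← ENNReal.tsum_mul_left]
  rw [← ENNReal.tsum_prod (f := fun (s : {T : Finset ℕ // ∀ i ∈ T, 0 < i}) (t : S) =>
    q ^ s.1.sum id * q ^ t.1.sum)]
  let e : (Σ n, {p : Overpartition n // p.nonoverlined ∈ S}) ≃
      {T : Finset ℕ // ∀ i ∈ T, 0 < i} × S :=
    { toFun := fun x => (⟨x.2.1.overlined, x.2.1.overlined_pos⟩, ⟨_, x.2.2⟩)
      invFun := fun y => ⟨y.1.1.sum id + y.2.1.sum,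
        ⟨⟨y.1.1, y.2.1, y.1.2, hS y.2.2, rfl⟩, y.2.2⟩⟩
      left_inv := by
        rintro ⟨n, ⟨p1, p2, h1, h2, rfl⟩, h⟩
        rfl
      right_inv := fun y => rfl }
  rw [← e.symm.tsum_eq]
  congr 1
  ext y
  exact pow_add _ _ _

lemma coeff_zero_le (a b : ℕ → ℕ) (hb : ∑' n, (b n : ℝ≥0∞) * (1 / 2) ^ n ≠ ⊤)
    (h : ∀ q : ℝ≥0∞, q ≤ 1 / 2 → q ≠ 0 → ∑' n, (a n : ℝ≥0∞) * q ^ n = ∑' n, (b n : ℝ≥0∞) * q ^ n) :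
    a 0 ≤ b 0 := by
  set B := ∑' n, (b (n + 1) : ℝ≥0∞) * (1 / 2) ^ n with hB
  have hBt : B ≠ ⊤ := by
    rw [tsum_eq_zero_add' ENNReal.summable] at hb
    intro hB'
    apply hb
    have : ∑' n, (b (n + 1) : ℝ≥0∞) * (1 / 2) ^ (n + 1) = B * (1 / 2) := by
      rw [hB, ← ENNReal.tsum_mul_right]; congr 1; ext n; ring
    rw [this, hB', ENNReal.top_mul (by simp)]; simp
  obtain ⟨q, hq0, hq⟩ : ∃ q : ℝ≥0∞, q ≠ 0 ∧ q ≤ 1 / 2 ∧ q * B < 1 := by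
    refine ⟨min (1 / 2) ((B + 1)⁻¹ / 2), ?_, min_le_left _ _, ?_⟩
    · simp [hBt]
    · calc _ ≤ ((B + 1)⁻¹ / 2) * (B + 1) := by gcongr; exact min_le_right _ _; simp
        _ = 1 / 2 := by
          rw [ENNReal.div_eq_inv_mul, mul_assoc, ENNReal.inv_mul_cancel (by simp) (by simp [hBt])]
          simp
        _ < 1 := by simp
  have h1 : (a 0 : ℝ≥0∞) ≤ b 0 + q * B := by
    calc (a 0 : ℝ≥0∞) = (a 0 : ℝ≥0∞) * q ^ 0 := by simp
      _ ≤ ∑' n, (a n : ℝ≥0∞) * q ^ n := ENNReal.le_tsum 0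
      _ = ∑' n, (b n : ℝ≥0∞) * q ^ n := h q hq.1 hq0
      _ = b 0 + ∑' n, (b (n + 1) : ℝ≥0∞) * q ^ (n + 1) := by
        rw [tsum_eq_zero_add' ENNReal.summable]; simp
      _ ≤ _ := by
        gcongr
        rw [hB, ← ENNReal.tsum_mul_left]
        apply ENNReal.tsum_le_tsum
        intro n
        calc (b (n + 1) : ℝ≥0∞) * q ^ (n + 1) = q * (b (n + 1) * q ^ n) := by ring
          _ ≤ _ := by gcongr; exact hq.1
  have h2 : (a 0 : ℝ≥0∞) < b 0 + 1 := lt_of_le_of_lt h1 (by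
    exact ENNReal.add_lt_add_left (by simp) hq.2)
  have : a 0 < b 0 + 1 := by exact_mod_cast h2
  lia

lemma coeff_unique (n : ℕ) : ∀ (a b : ℕ → ℕ) (_ : ∑' n, (b n : ℝ≥0∞) * (1 / 2) ^ n ≠ ⊤)
    (_ : ∀ q : ℝ≥0∞, q ≤ 1 / 2 → q ≠ 0 → ∑' n, (a n : ℝ≥0∞) * q ^ n = ∑' n, (b n : ℝ≥0∞) * q ^ n),
    a n = b n := by
  have h0 : ∀ (a b : ℕ → ℕ) (_ : ∑' n, (b n : ℝ≥0∞) * (1 / 2) ^ n ≠ ⊤)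
      (_ : ∀ q : ℝ≥0∞, q ≤ 1 / 2 → q ≠ 0 →
        ∑' n, (a n : ℝ≥0∞) * q ^ n = ∑' n, (b n : ℝ≥0∞) * q ^ n), a 0 = b 0 := by
    intro a b hb h
    refine le_antisymm (coeff_zero_le a b hb h) (coeff_zero_le b a ?_ fun q hq hq0 => (h q hq hq0).symm)
    rw [h (1 / 2) le_rfl (by simp)]; exact hb
  have hsh : ∀ (b : ℕ → ℕ) (q : ℝ≥0∞), ∑' n, (b n : ℝ≥0∞) * q ^ n =
      b 0 + q * ∑' n, (b (n + 1) : ℝ≥0∞) * q ^ n := by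
    intro b q
    rw [tsum_eq_zero_add' ENNReal.summable, ← ENNReal.tsum_mul_left]
    simp only [pow_zero, mul_one]
    congr 2; ext n; ring
  induction n with
  | zero => exact h0
  | succ n ih =>
    intro a b hb h
    have h00 := h0 a b hb h
    apply ih (fun n => a (n + 1)) (fun n => b (n + 1))
    · intro ht
      apply hb
      rw [hsh, ht, ENNReal.mul_top (by simp)]; simp
    · intro q hq hq0
      have := h q hq hq0
      rw [hsh a, hsh b, h00, ENNReal.add_right_inj (by simp)] at this
      exact (ENNReal.mul_right_inj hq0 (ne_top_of_le_ne_top (by simp) hq)).1 this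

end CrankProof

namespace CrankProof
open scoped ENNReal
open Filter Topology

/-- number of overpartitions -/
noncomputable def pb (n : ℕ) : ℕ := opc Pos n

/-- the Euler product -/
noncomputable def PP (q : ℂ) : ℂ := ∏' n : ℕ, (1 - q ^ (n + 1))

lemma PP_tendsto {q : ℂ} (hq : ‖q‖ < 1) :
    Tendsto (fun k => ∏ i ∈ Finset.range k, (1 - q ^ (i + 1))) atTop (𝓝 (PP q)) :=
  (ModularForm.multipliable_one_sub_pow hq).hasProd.tendsto_prod_nat

lemma one_sub_pow_ne {q : ℂ} (hq : ‖q‖ < 1) (i : ℕ) : 1 - q ^ (i + 1) ≠ 0 := by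
  intro h
  have h1 : q ^ (i + 1) = 1 := (sub_eq_zero.1 h).symm
  have h2 : ‖q‖ ^ (i + 1) < 1 := pow_lt_one₀ (norm_nonneg _) hq (by simp)
  rw [← norm_pow, h1] at h2
  simp at h2

lemma PP_ne_zero {q : ℂ} (hq : ‖q‖ < 1) : PP q ≠ 0 := by
  have := tprod_one_add_ne_zero_of_summable (f := fun n : ℕ => -q ^ (n + 1)) ?_ ?_
  · simpa only [PP, sub_eq_add_neg] using this
  · intro i; simpa only [sub_eq_add_neg] using one_sub_pow_ne hq i
  · simpa using (summable_nat_add_iff 1).mpr (summable_geometric_of_lt_one (norm_nonneg _) hq)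

lemma QQ_tendsto (q : ℝ≥0∞) :
    Tendsto (fun k => ∏ i ∈ Finset.range k, (1 + q ^ (i + 1))) atTop (𝓝 (QQ q)) := by
  have h : QQ q = ∑' s : Finset ℕ, ∏ i ∈ s, q ^ (i + 1) := by
    unfold QQ
    let e : Finset ℕ ≃ {T : Finset ℕ // ∀ i ∈ T, 0 < i} :=
      { toFun := fun s => ⟨s.map ⟨Nat.succ, Nat.succ_injective⟩, by simp⟩
        invFun := fun T => T.1.image (· - 1)
        left_inv := fun s => by
          ext i; simp
        right_inv := fun T => by
          ext i
          simp only [Finset.mem_map, Finset.mem_image, Function.Embedding.coeFn_mk]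
          constructor
          · rintro ⟨a, ⟨b, hb, rfl⟩, rfl⟩
            have := T.2 b hb
            rwa [show (b - 1).succ = b by lia]
          · intro hi
            have := T.2 i hi
            exact ⟨i - 1, ⟨i, hi, rfl⟩, by lia⟩ }
    rw [← e.tsum_eq]
    congr 1
    ext s
    simp [e, Finset.prod_pow_eq_pow_sum]
  rw [h]
  exact (hasProd_one_add_of_hasSum_prod (f := fun i : ℕ => q ^ (i + 1))
    ENNReal.summable.hasSum).tendsto_prod_nat

lemma SS_tendsto_ff (q : ℝ≥0∞) : Tendsto (ff q) atTop (𝓝 (SS q 1 0)) := by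
  have h : HasSum (fun k => q ^ k * ff q k) (SS q 1 0) := by
    have : SS q 1 0 = ∑' k, q ^ k * ff q k := by unfold SS; simp
    rw [this]; exact ENNReal.summable.hasSum
  have h1 := h.tendsto_sum_nat.comp (tendsto_add_atTop_nat 1)
  refine h1.congr fun m => sum_ff q m

lemma QQSS_real {q : ℝ} (hq0 : 0 ≤ q) (hq : q < 1) :
    QQ (ENNReal.ofReal q) * SS (ENNReal.ofReal q) 1 0 ≠ ⊤ ∧
    ((QQ (ENNReal.ofReal q) * SS (ENNReal.ofReal q) 1 0).toReal : ℂ) =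
      PP ((q : ℂ) ^ 2) / PP q ^ 2 := by
  set Q := ENNReal.ofReal q with hQ
  set G : ℕ → ℝ := fun k => (∏ i ∈ Finset.range k, (1 + q ^ (i + 1))) *
    ∏ i ∈ Finset.range k, (1 - q ^ (i + 1))⁻¹
  have hlt : ∀ i : ℕ, q ^ (i + 1) < 1 := fun i => pow_lt_one₀ hq0 hq (by simp)
  have hG0 : ∀ k, 0 ≤ G k := by
    intro k
    apply mul_nonneg <;> apply Finset.prod_nonneg <;> intro i _
    · positivity
    · have := hlt i; exact inv_nonneg.2 (by linarith)
  have hGe : ∀ k, (∏ i ∈ Finset.range k, (1 + Q ^ (i + 1))) * ff Q k = ENNReal.ofReal (G k) := by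
    intro k
    rw [ENNReal.ofReal_mul, ENNReal.ofReal_prod_of_nonneg, ENNReal.ofReal_prod_of_nonneg, ff]
    · congr 1 <;> apply Finset.prod_congr rfl <;> intro i _
      · rw [ENNReal.ofReal_add (by simp) (by positivity), ENNReal.ofReal_pow hq0]; simp [hQ]
      · have := hlt i
        rw [ENNReal.ofReal_inv_of_pos (by linarith), ENNReal.ofReal_sub _ (by positivity),
          ENNReal.ofReal_pow hq0]; simp [hQ]
    · intro i _; have := hlt i; exact inv_nonneg.2 (by linarith)
    · intro i _; positivity
    · apply Finset.prod_nonneg; intro i _; positivity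
  have hqc : ‖(q : ℂ)‖ < 1 := by simpa [abs_of_nonneg hq0] using hq
  have hqc2 : ‖(q : ℂ) ^ 2‖ < 1 := by
    rw [norm_pow]; exact pow_lt_one₀ (norm_nonneg _) hqc (by simp)
  have h1 : Tendsto (fun k => (G k : ℂ)) atTop (𝓝 (PP ((q : ℂ) ^ 2) / PP q ^ 2)) := by
    refine ((PP_tendsto hqc2).div ((PP_tendsto hqc).pow 2)
      (pow_ne_zero 2 (PP_ne_zero hqc))).congr fun k => ?_
    simp only [G, Pi.div_apply]
    push_cast
    rw [← Finset.prod_pow, ← Finset.prod_div_distrib, ← Finset.prod_mul_distrib]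
    apply Finset.prod_congr rfl
    intro i _
    have := one_sub_pow_ne hqc i
    field_simp
    ring
  set X := PP ((q : ℂ) ^ 2) / PP q ^ 2
  have h2 : Tendsto G atTop (𝓝 ‖X‖) := by
    refine h1.norm.congr fun k => ?_
    simp [abs_of_nonneg (hG0 k)]
  have h3 : Tendsto (fun k => ENNReal.ofReal (G k)) atTop (𝓝 (ENNReal.ofReal ‖X‖)) :=
    ENNReal.tendsto_ofReal h2
  have hQ0 : QQ Q ≠ 0 := by
    have : 1 ≤ QQ Q := ge_of_tendsto' (QQ_tendsto Q) fun k =>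
      Finset.one_le_prod' (fun i _ => le_self_add)
    exact (lt_of_lt_of_le one_pos this).ne'
  have hS0 : SS Q 1 0 ≠ 0 := by
    have := ff_le_SS Q 0
    rw [ff_zero] at this
    exact (lt_of_lt_of_le one_pos this).ne'
  have h4 := ENNReal.Tendsto.mul (QQ_tendsto Q) (Or.inl hQ0) (SS_tendsto_ff Q) (Or.inl hS0)
  simp_rw [hGe] at h4
  have h5 := tendsto_nhds_unique h4 h3
  rw [h5]
  refine ⟨ENNReal.ofReal_ne_top, ?_⟩
  rw [ENNReal.toReal_ofReal (norm_nonneg _)]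
  exact tendsto_nhds_unique ((Complex.continuous_ofReal.tendsto _).comp h2) h1

lemma QQ_ne_zero (q : ℝ≥0∞) : QQ q ≠ 0 := by
  have : 1 ≤ QQ q := ge_of_tendsto' (QQ_tendsto q) fun k =>
      Finset.one_le_prod' (fun i _ => le_self_add)
  exact (lt_of_lt_of_le one_pos this).ne'

lemma QQSS_ne_top {q : ℝ≥0∞} (hq : q < 1) : QQ q * SS q 1 0 ≠ ⊤ := by
  have hqt : q ≠ ⊤ := hq.ne_top
  have := (QQSS_real (q := q.toReal) ENNReal.toReal_nonneg (by
    rw [← ENNReal.toReal_one]; exact (ENNReal.toReal_lt_toReal hqt (by simp)).2 hq)).1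
  rwa [ENNReal.ofReal_toReal hqt] at this

lemma SS_ne_top {q : ℝ≥0∞} (hq : q < 1) : SS q 1 0 ≠ ⊤ := by
  intro h
  apply QQSS_ne_top hq
  rw [h, ENNReal.mul_top (QQ_ne_zero q)]

lemma gf_real {q : ℝ} (hq0 : 0 ≤ q) (hq : q < 1) :
    HasSum (fun n => (pb n : ℝ) * q ^ n)
      (QQ (ENNReal.ofReal q) * SS (ENNReal.ofReal q) 1 0).toReal := by
  have hq' : ENNReal.ofReal q < 1 := by
    rw [← ENNReal.ofReal_one]; exact (ENNReal.ofReal_lt_ofReal_iff one_pos).2 hq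
  have h := gf (ENNReal.ofReal q) Pos le_rfl
  rw [WW_pos hq'] at h
  have h2 := ENNReal.hasSum_toReal (f := fun n => (opc Pos n : ℝ≥0∞) * ENNReal.ofReal q ^ n)
    (by rw [h]; exact QQSS_ne_top hq')
  rw [← h, ENNReal.tsum_toReal_eq]
  · convert h2 using 2 with n
    simp [pb, hq0]
  · intro n
    exact ENNReal.mul_ne_top (by simp) (ENNReal.pow_ne_top (by simp))

lemma summable_pb {q : ℝ} (hq0 : 0 ≤ q) (hq : q < 1) : Summable (fun n => (pb n : ℝ) * q ^ n) :=
  (gf_real hq0 hq).summable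

lemma summable_pbC {q : ℂ} (hq : ‖q‖ < 1) : Summable (fun n => (pb n : ℂ) * q ^ n) := by
  apply Summable.of_norm
  simpa using summable_pb (norm_nonneg q) hq

/-- the generating function -/
noncomputable def FF (q : ℂ) : ℂ := ∑' n, (pb n : ℂ) * q ^ n

lemma FF_diff : DifferentiableOn ℂ FF (Metric.ball 0 1) := by
  intro q hq
  have hq1 : ‖q‖ < 1 := by simpa using hq
  set R := (1 + ‖q‖) / 2
  have hR : R < 1 := by simp only [R]; linarith
  have hR0 : 0 ≤ R := by positivity
  have h1 : DifferentiableOn ℂ FF (Metric.ball 0 R) := by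
    apply Complex.differentiableOn_tsum_of_summable_norm (summable_pb hR0 hR)
    · intro i; fun_prop
    · exact Metric.isOpen_ball
    · intro i w hw
      have : ‖w‖ ≤ R := by simpa using (mem_ball_zero_iff.1 hw).le
      simp only [norm_mul, norm_pow, Complex.norm_natCast]
      gcongr
  have h2 : q ∈ Metric.ball (0 : ℂ) R := by
    rw [mem_ball_zero_iff]; simp only [R]; linarith
  exact ((h1 q h2).differentiableAt (Metric.isOpen_ball.mem_nhds h2)).differentiableWithinAt

lemma FF_eq {q : ℂ} (hq : ‖q‖ < 1) : FF q = PP (q ^ 2) / PP q ^ 2 := by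
  have hP : DifferentiableOn ℂ PP (Metric.ball 0 1) := ModularForm.differentiableOn_tprod_one_sub_pow
  have hmaps : ∀ q ∈ Metric.ball (0 : ℂ) 1, q ^ 2 ∈ Metric.ball (0 : ℂ) 1 := by
    intro q hq
    rw [mem_ball_zero_iff] at *
    rw [norm_pow]; exact pow_lt_one₀ (norm_nonneg _) hq (by simp)
  have hr : DifferentiableOn ℂ (fun q => PP (q ^ 2) / PP q ^ 2) (Metric.ball 0 1) := by
    apply DifferentiableOn.div
    · exact hP.comp (f := fun q : ℂ => q ^ 2) (by fun_prop) hmaps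
    · exact hP.pow 2
    · intro q hq; exact pow_ne_zero 2 (PP_ne_zero (by simpa using hq))
  have h1 := FF_diff.analyticOnNhd Metric.isOpen_ball
  have h2 := hr.analyticOnNhd Metric.isOpen_ball
  have h3 := h1.eqOn_of_preconnected_of_frequently_eq h2 (convex_ball (0 : ℂ) 1).isPreconnected
    (z₀ := 0) (by simp) ?_
  · exact h3 (by simpa using hq)
  · have ht : Tendsto (fun n : ℕ => (((1 : ℝ) / (n + 2) : ℝ) : ℂ)) atTop (𝓝[≠] 0) := by
      rw [tendsto_nhdsWithin_iff]
      constructor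
      · have : Tendsto (fun n : ℕ => (1 : ℝ) / (n + 2)) atTop (𝓝 0) := by
          have := (tendsto_one_div_add_atTop_nhds_zero_nat (𝕜 := ℝ)).comp (tendsto_add_atTop_nat 1)
          refine this.congr fun n => ?_
          simp only [Function.comp]; push_cast; ring
        have := (Complex.continuous_ofReal.tendsto _).comp this
        rw [Complex.ofReal_zero] at this
        exact this
      · filter_upwards with n
        simp only [Set.mem_compl_iff, Set.mem_singleton_iff, Complex.ofReal_eq_zero]
        positivity
    refine ht.frequently (Frequently.of_forall fun n => ?_)
    have hn0 : (0 : ℝ) ≤ (1 : ℝ) / (n + 2) := by positivity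
    have hn1 : (1 : ℝ) / (n + 2) < 1 := by
      rw [div_lt_one (by positivity)]; linarith [(Nat.cast_nonneg n : (0 : ℝ) ≤ n)]
    rw [← (QQSS_real hn0 hn1).2, FF, ← (gf_real hn0 hn1).tsum_eq]
    push_cast
    rfl

end CrankProof

namespace CrankProof
open scoped ENNReal
open Filter Topology

noncomputable def ct (m N : ℕ) : ℕ :=
  opc (Cr m) N + if m = 1 then (if 1 ≤ N then opc {0} (N - 1) else 0) else 0

lemma shift_gf (f : ℕ → ℕ) (m : ℕ) (q : ℝ≥0∞) :
    ∑' N, ((if m ≤ N then f (N - m) else 0 : ℕ) : ℝ≥0∞) * q ^ N =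
      q ^ m * ∑' n, (f n : ℝ≥0∞) * q ^ n := by
  rw [← Summable.sum_add_tsum_nat_add' (k := m) ENNReal.summable, Finset.sum_eq_zero, zero_add,
    ← ENNReal.tsum_mul_left]
  · congr 1; ext n; simp; ring
  · intro i hi
    rw [Finset.mem_range] at hi
    simp [hi]

lemma ct_gf {q : ℝ≥0∞} (hq : q < 1) (m : ℕ) (hm : 1 ≤ m) :
    ∑' N, (ct m N : ℝ≥0∞) * q ^ N = QQ q * RR q m := by
  rw [← WW_Cr hq (SS_ne_top hq) m hm, mul_add, ← gf q (Cr m) (fun s hs => hs.1)]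
  unfold ct
  simp only [Nat.cast_add, add_mul]
  rw [ENNReal.tsum_add]
  congr 1
  by_cases h : m = 1
  · simp only [h, if_true]
    have h2 := gf q {0} (by rintro s rfl; simp [Pos])
    rw [shift_gf (opc {0}) 1 q, h2, WW_singleton]
    simp [mul_comm]
  · simp [h]

lemma ct_rec (m N : ℕ) (hm : 1 ≤ m) :
    ct m N + (if m ≤ N then ct (m + 1) (N - m) else 0) = if m ≤ N then pb (N - m) else 0 := by
  have hpb : ∀ q : ℝ≥0∞, q < 1 → ∑' n, (pb n : ℝ≥0∞) * q ^ n = QQ q * SS q 1 0 := by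
    intro q hq
    rw [← WW_pos hq]; exact gf q Pos le_rfl
  apply coeff_unique N (fun N => ct m N + (if m ≤ N then ct (m + 1) (N - m) else 0))
    (fun N => if m ≤ N then pb (N - m) else 0)
  · rw [shift_gf pb m, hpb _ (by simp)]
    exact ENNReal.mul_ne_top (ENNReal.pow_ne_top (by simp)) (QQSS_ne_top (by simp))
  · intro q hq _
    have hq1 : q < 1 := lt_of_le_of_lt hq (by simp)
    simp only [Nat.cast_add, add_mul]
    rw [ENNReal.tsum_add, shift_gf pb m, hpb q hq1, shift_gf (ct (m + 1)) m,
      ct_gf hq1 m hm, ct_gf hq1 (m + 1) (by lia)]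
    have := RR_rec hq1 (SS_ne_top hq1) m
    calc _ = QQ q * (RR q m + q ^ m * RR q (m + 1)) := by ring
      _ = _ := by rw [this]; ring

lemma opc_mono {S T : Set (Multiset ℕ)} (h : S ⊆ T) (n : ℕ) : opc S n ≤ opc T n := by
  unfold opc
  exact Nat.card_le_card_of_injective (fun p => ⟨p.1, h p.2⟩) (fun p p' hp => by
    simpa [Subtype.ext_iff] using hp)

lemma ct_le (m N : ℕ) (hm : 1 ≤ m) : ct m N ≤ if m ≤ N then pb (N - m) else 0 := by
  have := ct_rec m N hm
  lia

lemma crank_le {N : ℕ} (p : Overpartition N) : p.crank ≤ N := by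
  have h1 := p.total
  have h2 := card_le_sum' _ p.nonoverlined_pos
  unfold Overpartition.crank multisetCrank
  split_ifs with h
  · have : p.nonoverlined.sup ≤ p.nonoverlined.sum :=
      Multiset.sup_le.2 fun i hi => Multiset.le_sum_of_mem hi
    have : p.nonoverlined.sup ≤ N := by lia
    exact_mod_cast this
  · have := Multiset.card_le_card (Multiset.filter_le
      (fun part => p.nonoverlined.count 1 < part) p.nonoverlined)
    lia

lemma Mbar_eq (m N : ℕ) : opc (Cr m) N = Mbar m N + opc (Cr (m + 1)) N := by
  classical
  unfold Mbar opc
  have : {p : Overpartition N // p.nonoverlined ∈ Cr m} ≃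
      {p : Overpartition N // p.crank = m} ⊕ {p : Overpartition N // p.nonoverlined ∈ Cr (m + 1)} := by
    refine Equiv.trans (Equiv.subtypeEquivRight (q := fun p : Overpartition N =>
      p.crank = (m : ℤ) ∨ p.nonoverlined ∈ Cr (m + 1))
      fun p => ?_) (subtypeOrEquiv _ _ ?_)
    · simp only [Cr, Overpartition.crank, Set.mem_ofPred_eq]
      have := p.nonoverlined_pos
      constructor
      · rintro ⟨h1, h2⟩
        by_cases h : multisetCrank p.nonoverlined = m
        · exact Or.inl h
        · refine Or.inr ⟨h1, ?_⟩; push_cast; lia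
      · rintro (h | ⟨h1, h2⟩)
        · exact ⟨this, h.ge⟩
        · refine ⟨h1, ?_⟩; push_cast at h2; lia
    · rw [Pi.disjoint_iff]
      intro p
      simp only [Prop.disjoint_iff, Cr, Overpartition.crank, Set.mem_ofPred_eq]
      push_cast
      lia
  rw [Nat.card_congr this, Nat.card_sum]

lemma opc_Cr_zero (m N : ℕ) (h : N < m) : opc (Cr m) N = 0 := by
  unfold opc
  rw [Nat.card_eq_zero]
  left
  constructor
  rintro ⟨p, hp⟩
  have := crank_le p
  have h2 := hp.2
  unfold Overpartition.crank at this
  lia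

lemma Mplus_eq (r N : ℕ) (hr : 1 ≤ r) : Mplus r N =
    ∑ m ∈ Finset.range N, (((m : ℝ) + 1) ^ r - (m : ℝ) ^ r) * opc (Cr (m + 1)) N := by
  unfold Mplus
  rw [tsum_eq_sum (s := Finset.range N)]
  · have h1 : ∀ m : ℕ, ((m : ℝ) + 1) ^ r * (Mbar ((m : ℤ) + 1) N : ℝ) =
        (((m : ℝ) + 1) ^ r - (m : ℝ) ^ r) * opc (Cr (m + 1)) N -
        (((m + 1 : ℕ) : ℝ) ^ r * opc (Cr (m + 1 + 1)) N - (m : ℝ) ^ r * opc (Cr (m + 1)) N) := by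
      intro m
      have := Mbar_eq (m + 1) N
      push_cast at this
      rw [this]; push_cast; ring
    simp_rw [h1]
    rw [Finset.sum_sub_distrib, Finset.sum_range_sub (fun m : ℕ => (m : ℝ) ^ r * opc (Cr (m + 1)) N),
      opc_Cr_zero _ _ (Nat.lt_succ_self N)]
    simp [show r ≠ 0 by lia]
  · intro m hm
    rw [Finset.mem_range, not_lt] at hm
    have := Mbar_eq (m + 1) N
    rw [opc_Cr_zero (m + 1) N (by lia)] at this
    push_cast at this
    have : Mbar ((m : ℤ) + 1) N = 0 := by lia
    simp [this]

lemma opc_zero_le (N : ℕ) : opc {0} N ≤ pb N := opc_mono (by rintro s rfl; simp [Pos]) N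

end CrankProof

namespace CrankProof
open Filter Topology Complex
open scoped Real

noncomputable def Cz (z : ℂ) : ℂ := (I * z / (2 * π)) * Complex.sqrt I / (I * Complex.sqrt (I * z / π))

lemma eta_PP (τ : ℂ) : ModularForm.eta τ = exp (2 * π * I * τ / 24) * PP (exp (2 * π * I * τ)) := by
  unfold ModularForm.eta PP
  simp_rw [ModularForm.eta_q_eq_pow]
  simp [Function.Periodic.qParam]

lemma eta_S {τ : ℂ} (hτ : 0 < τ.im) :
    Complex.sqrt τ * ModularForm.eta τ = Complex.sqrt I * ModularForm.eta (-1 / τ) := by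
  have h := ModularForm.eta_comp_eq_csqrt_I_inv (x := τ) hτ
  simp only [Function.comp, Pi.smul_apply, Pi.mul_apply, smul_eq_mul] at h
  rw [h, mul_inv_cancel_left₀]
  simp [Complex.sqrt]

lemma sqrt_sq' (τ : ℂ) : Complex.sqrt τ ^ 2 = τ := by
  unfold Complex.sqrt
  rw [← Complex.cpow_nat_mul]; simp

lemma sqrt_ne {τ : ℂ} (hτ : τ ≠ 0) : Complex.sqrt τ ≠ 0 := by simp [Complex.sqrt, hτ]

lemma FF_mod {z : ℂ} (hz : 0 < z.re) : FF (exp (-z)) =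
    Cz z * exp (π ^ 2 / (4 * z)) * (PP (exp (-2 * π ^ 2 / z)) / PP (exp (-4 * π ^ 2 / z)) ^ 2) := by
  have hz0 : z ≠ 0 := by rintro rfl; simp at hz
  have hpi : (π : ℂ) ≠ 0 := by exact_mod_cast Real.pi_ne_zero
  have him : ∀ c : ℝ, 0 < c → 0 < (I * z / (c * π)).im := by
    intro c hc
    have : I * z / (c * π) = (((c * π)⁻¹ : ℝ) : ℂ) * (I * z) := by push_cast; field_simp
    rw [this, Complex.im_ofReal_mul]
    have : 0 < (I * z).im := by simpa using hz
    positivity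
  have h1 := eta_S (him 2 two_pos)
  have h2 := eta_S (him 1 one_pos)
  rw [eta_PP, eta_PP] at h1 h2
  push_cast at h1 h2
  rw [one_mul] at h2
  have hq : ‖exp (-z)‖ < 1 := by rw [Complex.norm_exp]; simpa using hz
  rw [FF_eq hq]
  have hre : ∀ c : ℝ, 0 < c → ‖exp (-c * π ^ 2 / z)‖ < 1 := by
    intro c hc
    have : -c * π ^ 2 / z = ((-(c * π ^ 2) : ℝ) : ℂ) * z⁻¹ := by push_cast; field_simp
    rw [Complex.norm_exp, this, Complex.re_ofReal_mul, Complex.inv_re]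
    rw [Real.exp_lt_one_iff]
    have : 0 < Complex.normSq z := Complex.normSq_pos.2 hz0
    have : 0 < c * π ^ 2 * (z.re / Complex.normSq z) := by positivity
    linarith
  have e1 : 2 * π * I * (I * z / (2 * π)) = -z := by field_simp; simp
  have e2 : 2 * π * I * (I * z / π) = 2 * (-z) := by field_simp; simp
  have e3 : 2 * π * I * (-1 / (I * z / (2 * π))) = -4 * π ^ 2 / z := by field_simp; norm_num
  have e4 : 2 * π * I * (-1 / (I * z / π)) = -2 * π ^ 2 / z := by field_simp
  rw [e1, e3] at h1
  rw [e2, e4] at h2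
  rw [← Complex.exp_nat_mul]
  push_cast
  have s1 : Complex.sqrt (I * z / (2 * π)) ^ 2 = I * z / (2 * π) := sqrt_sq' _
  have s0 : Complex.sqrt I ^ 2 = I := sqrt_sq' _
  have n1 : Complex.sqrt (I * z / (2 * π)) ≠ 0 := sqrt_ne (by simp [hz0, hpi])
  have n2 : Complex.sqrt (I * z / π) ≠ 0 := sqrt_ne (by simp [hz0, hpi])
  have p1 := PP_ne_zero hq
  have p2 := PP_ne_zero (hre 4 (by norm_num))
  push_cast at p2
  have h1' := congrArg (· ^ 2) h1
  simp only [mul_pow, s1, s0] at h1'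
  unfold Cz
  have e5 : exp (2 * (-z) / 24) = exp (-z / 24) ^ 2 := by
    rw [← Complex.exp_nat_mul]; congr 1; push_cast; ring
  have e6 : exp (-4 * π ^ 2 / z / 24) = exp (-2 * π ^ 2 / z / 24) ^ 2 := by
    rw [← Complex.exp_nat_mul]; congr 1; push_cast; ring
  have e7 : exp (π ^ 2 / (4 * z)) * exp (-2 * π ^ 2 / z / 24) ^ 3 = 1 := by
    rw [← Complex.exp_nat_mul, ← Complex.exp_add, ← Complex.exp_zero]; congr 1
    push_cast; field_simp; ring
  rw [e5] at h2
  rw [e6] at h1'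
  have b0 := Complex.exp_ne_zero (-2 * π ^ 2 / z / 24)
  have a0 := Complex.exp_ne_zero (-z / 24)
  rw [eq_inv_of_mul_eq_one_left e7]
  have I0 := Complex.I_ne_zero
  generalize exp (-2 * π ^ 2 / z / 24) = b at *
  generalize exp (-z / 24) = a at *
  generalize PP (exp (-z)) = P1 at *
  generalize PP (exp (2 * -z)) = P2 at *
  generalize PP (exp (-2 * π ^ 2 / z)) = Pu at *
  generalize PP (exp (-4 * π ^ 2 / z)) = P4 at *
  generalize Complex.sqrt (I * z / π) = S2 at *
  generalize Complex.sqrt I = SI at *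
  have k0 : I * z / (2 * π) ≠ 0 := by simp [hz0, hpi]
  generalize I * z / (2 * π) = k at *
  have hP2 : P2 = SI * b * Pu / (S2 * a ^ 2) := by
    field_simp; linear_combination h2
  have hP1 : P1 ^ 2 = I * b ^ 4 * P4 ^ 2 / (k * a ^ 2) := by
    field_simp; linear_combination h1'
  rw [hP2, hP1]
  field_simp

end CrankProof

namespace CrankProof
open Filter Topology Complex
open scoped Real

lemma sqrt_real_mul {x : ℝ} (hx : 0 < x) {w : ℂ} (hw : w ≠ 0) :
    Complex.sqrt (x * w) = (√x : ℝ) * Complex.sqrt w := by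
  have hx0 : (x : ℂ) ≠ 0 := by exact_mod_cast hx.ne'
  rw [sqrt_eq_exp (mul_ne_zero hx0 hw), sqrt_eq_exp hw, Complex.log_ofReal_mul hx hw, add_div,
    Complex.exp_add]
  congr 1
  rw [← Real.exp_log hx, ← Real.exp_half, Real.exp_log hx]
  push_cast
  rfl

lemma Cz_scale {x : ℝ} (hx : 0 < x) {w : ℂ} (hw : w ≠ 0) : Cz (x * w) = (√x : ℝ) * Cz w := by
  unfold Cz
  have hpi : (π : ℂ) ≠ 0 := by exact_mod_cast Real.pi_ne_zero
  have hw2 : I * w / π ≠ 0 := by simp [hw, hpi]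
  rw [show I * (x * w) / π = x * (I * w / π) by ring, sqrt_real_mul hx hw2]
  have h1 := sqrt_ne hw2
  have h2 : ((√x : ℝ) : ℂ) ≠ 0 := by exact_mod_cast (Real.sqrt_pos.2 hx).ne'
  have h3 : (x : ℂ) = (√x : ℝ) * (√x : ℝ) := by
    rw [← Complex.ofReal_mul, Real.mul_self_sqrt hx.le]
  have I0 := Complex.I_ne_zero
  generalize Complex.sqrt (I * w / π) = S at *
  field_simp
  rw [h3]
  generalize ((√x : ℝ) : ℂ) = r at *
  field_simp

lemma Cz_one : Cz 1 = (1 / (2 * √π) : ℝ) := by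
  unfold Cz
  have hpi : (π : ℂ) ≠ 0 := by exact_mod_cast Real.pi_ne_zero
  have h0 := sqrt_ne Complex.I_ne_zero
  rw [show I * 1 / π = ((π⁻¹ : ℝ) : ℂ) * I by push_cast; field_simp,
    sqrt_real_mul (by positivity) Complex.I_ne_zero]
  have h2 : ((√π : ℝ) : ℂ) ≠ 0 := by exact_mod_cast (Real.sqrt_pos.2 Real.pi_pos).ne'
  have h3 : (π : ℂ) = (√π : ℝ) * (√π : ℝ) := by
    rw [← Complex.ofReal_mul, Real.mul_self_sqrt Real.pi_pos.le]
  have I0 := Complex.I_ne_zero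
  rw [Real.sqrt_inv]
  push_cast
  generalize Complex.sqrt I = S at *
  field_simp
  rw [h3]
  ring

lemma Cz_cont : ContinuousAt Cz 1 := by
  have hpi : (π : ℂ) ≠ 0 := by exact_mod_cast Real.pi_ne_zero
  have hs : I * 1 / π ∈ slitPlane := by
    right
    rw [mul_one, Complex.div_ofReal_im]
    simp
  have h1 : ContinuousAt (fun z : ℂ => Complex.sqrt (I * z / π)) 1 := by
    apply ContinuousAt.comp (f := fun z : ℂ => I * z / π) (g := Complex.sqrt)
    · exact (differentiableAt_sqrt hs).continuousAt
    · fun_prop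
  unfold Cz
  apply ContinuousAt.div
  · fun_prop
  · fun_prop
  · exact mul_ne_zero I_ne_zero (sqrt_ne (slitPlane_ne_zero hs))

lemma PP_lim : Tendsto PP (𝓝 0) (𝓝 1) := by
  have hP : DifferentiableOn ℂ PP (Metric.ball 0 1) := ModularForm.differentiableOn_tprod_one_sub_pow
  have h := (hP.differentiableAt (Metric.ball_mem_nhds 0 one_pos)).continuousAt.tendsto
  have : PP 0 = 1 := by unfold PP; simp
  rwa [this] at h

/-- rescaled variable -/
noncomputable def zt (t v : ℝ) : ℂ := 1 + ((2 / π * v / √t : ℝ) : ℂ) * I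

noncomputable def xt (t : ℝ) : ℝ := π / (2 * t)

noncomputable def GG (t v : ℝ) : ℂ :=
  (√t : ℝ) * exp (-(π * t : ℝ) + (t ^ 2 : ℝ) * (xt t * zt t v)) * FF (exp (-(xt t * zt t v)))

lemma zt_re (t v : ℝ) : (zt t v).re = 1 := by simp [zt]
lemma zt_ne (t v : ℝ) : zt t v ≠ 0 := by
  intro h; have := zt_re t v; rw [h] at this; simp at this

lemma GG_eq {t : ℝ} (ht : 0 < t) (v : ℝ) : GG t v = (√(π / 2) : ℝ) * Cz (zt t v) *
    exp (-(2 / π * v ^ 2 : ℝ) / zt t v) *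
    (PP (exp (-(4 * π * t : ℝ) / zt t v)) / PP (exp (-(8 * π * t : ℝ) / zt t v)) ^ 2) := by
  have hx : 0 < xt t := by unfold xt; positivity
  have hz := zt_ne t v
  have hx0 : (xt t : ℂ) ≠ 0 := by exact_mod_cast hx.ne'
  have ht0 : (t : ℂ) ≠ 0 := by exact_mod_cast ht.ne'
  have hpi : (π : ℂ) ≠ 0 := by exact_mod_cast Real.pi_ne_zero
  have hxe : (xt t : ℂ) = π / (2 * t) := by unfold xt; push_cast; rfl
  unfold GG
  rw [FF_mod (by rw [Complex.re_ofReal_mul, zt_re]; simpa using hx), Cz_scale hx hz]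
  have e1 : (√(π / 2) : ℝ) = √t * √(xt t) := by
    rw [← Real.sqrt_mul ht.le]; congr 1; unfold xt; field_simp
  have hs : ((√t : ℝ) : ℂ) ^ 2 = t := by
    rw [← Complex.ofReal_pow, Real.sq_sqrt ht.le]
  have hs0 : ((√t : ℝ) : ℂ) ≠ 0 := by exact_mod_cast (Real.sqrt_pos.2 ht).ne'
  have e2 : exp (-(2 / π * v ^ 2 : ℝ) / zt t v) =
      exp (-(π * t : ℝ) + (t ^ 2 : ℝ) * (xt t * zt t v)) * exp (π ^ 2 / (4 * (xt t * zt t v))) := by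
    rw [← Complex.exp_add]
    congr 1
    have hv : (2 / π * v / (√t : ℝ) : ℂ) ^ 2 = - (zt t v - 1) ^ 2 := by
      unfold zt; push_cast; ring_nf; simp
    have hv2 : (v : ℂ) ^ 2 = - (zt t v - 1) ^ 2 * (π / 2) ^ 2 * t := by
      rw [← hv]
      field_simp
      rw [hs]
    rw [hxe]
    push_cast
    rw [hv2]
    field_simp
    ring
  have e3 : -2 * (π : ℂ) ^ 2 / (xt t * zt t v) = -(4 * π * t : ℝ) / zt t v := by
    rw [hxe]; push_cast; field_simp; ring
  have e4 : -4 * (π : ℂ) ^ 2 / (xt t * zt t v) = -(8 * π * t : ℝ) / zt t v := by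
    rw [hxe]; push_cast; field_simp; ring
  rw [e1, e2, e3, e4]
  push_cast
  ring

lemma zt_lim (v : ℝ) : Tendsto (fun t => zt t v) atTop (𝓝 1) := by
  have h1 : Tendsto (fun t : ℝ => 2 / π * v / √t) atTop (𝓝 0) :=
    tendsto_const_nhds.div_atTop Real.tendsto_sqrt_atTop
  have h2 := ((Complex.continuous_ofReal.tendsto _).comp h1).mul_const I
  have h3 := h2.const_add 1
  simp only [ofReal_zero, zero_mul, add_zero] at h3
  exact h3

lemma exp_lim {c : ℝ} (hc : 0 < c) (v : ℝ) :
    Tendsto (fun t : ℝ => exp (-(c * t : ℝ) / zt t v)) atTop (𝓝 0) := by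
  rw [tendsto_zero_iff_norm_tendsto_zero]
  have h1 : Tendsto (fun t => (zt t v)⁻¹.re) atTop (𝓝 1) := by
    have := (Complex.continuous_re.tendsto _).comp ((zt_lim v).inv₀ one_ne_zero)
    rw [inv_one, one_re] at this
    exact this
  have h2 : Tendsto (fun t : ℝ => (c * t) * (zt t v)⁻¹.re) atTop atTop :=
    (tendsto_id.const_mul_atTop hc).atTop_mul_pos one_pos h1
  have h3 := Real.tendsto_exp_neg_atTop_nhds_zero.comp h2
  refine h3.congr fun t => ?_
  simp only [Function.comp, Complex.norm_exp]
  congr 1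
  rw [show -((c * t : ℝ) : ℂ) / zt t v = ((-(c * t) : ℝ) : ℂ) * (zt t v)⁻¹ by push_cast; ring,
    Complex.re_ofReal_mul]
  ring

lemma GG_lim (v : ℝ) : Tendsto (fun t => GG t v) atTop
    (𝓝 ((1 / (2 * √2) * Real.exp (-(2 / π) * v ^ 2) : ℝ) : ℂ)) := by
  have h1 : Tendsto (fun t => Cz (zt t v)) atTop (𝓝 (Cz 1)) := Cz_cont.tendsto.comp (zt_lim v)
  have h2 : Tendsto (fun t => exp (-(2 / π * v ^ 2 : ℝ) / zt t v)) atTop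
      (𝓝 (exp (-(2 / π * v ^ 2 : ℝ) / 1))) := by
    exact (Complex.continuous_exp.tendsto _).comp (tendsto_const_nhds.div (zt_lim v) one_ne_zero)
  have h3 := PP_lim.comp (exp_lim (c := 4 * π) (by positivity) v)
  have h4 := PP_lim.comp (exp_lim (c := 8 * π) (by positivity) v)
  have h5 := ((h1.const_mul ((√(π / 2) : ℝ) : ℂ)).mul h2).mul (h3.div (h4.pow 2) (by simp))
  have : ((√(π / 2) : ℝ) : ℂ) * Cz 1 * exp (-(2 / π * v ^ 2 : ℝ) / 1) * (1 / 1 ^ 2) =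
      ((1 / (2 * √2) * Real.exp (-(2 / π) * v ^ 2) : ℝ) : ℂ) := by
    rw [Cz_one]
    rw [Real.sqrt_div Real.pi_pos.le]
    have : √π ≠ 0 := (Real.sqrt_pos.2 Real.pi_pos).ne'
    rw [show √π / √2 = (1 / √2) * √π by ring]
    have e : (1 / √2) * √π * (1 / (2 * √π)) = 1 / (2 * √2) := by field_simp
    rw [← Complex.ofReal_mul, e]
    push_cast
    simp
  rw [this] at h5
  refine h5.congr' ?_
  filter_upwards [eventually_gt_atTop 0] with t ht
  rw [GG_eq ht v]
  rfl

end CrankProof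

namespace CrankProof
open Filter Topology Complex
open scoped Real

lemma ratio_bound {w : ℂ} (hw : ‖w‖ < 1) :
    ‖(1 + w) / (1 - w)‖ ≤ (1 + ‖w‖) / (1 - ‖w‖) * Real.exp (-(‖w‖ - w.re) / 8) := by
  set r := ‖w‖
  set c := w.re
  have hr0 : 0 ≤ r := norm_nonneg _
  have hcr : c ≤ r := Complex.re_le_norm w
  have hcr2 : -r ≤ c := by
    have := Complex.abs_re_le_norm w; exact (abs_le.1 this).1
  have hn : r ^ 2 = w.re ^ 2 + w.im ^ 2 := by
    rw [Complex.sq_norm, Complex.normSq_apply]; ring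
  have h1 : ‖1 + w‖ ^ 2 = 1 + r ^ 2 + 2 * c := by
    rw [Complex.sq_norm, Complex.normSq_apply, hn]; simp; ring
  have h2 : ‖1 - w‖ ^ 2 = 1 + r ^ 2 - 2 * c := by
    rw [Complex.sq_norm, Complex.normSq_apply, hn]; simp; ring
  rw [norm_div]
  have h1r : 0 < 1 - r := by linarith
  refine le_of_sq_le_sq ?_ (by positivity)
  rw [div_pow, h1, h2, mul_pow, div_pow, ← Real.exp_nat_mul]
  set s := r - c with hs
  have hs0 : 0 ≤ s := by linarith
  have hs2 : s ≤ 2 := by linarith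
  have e1 : ((2 : ℕ) : ℝ) * (-s / 8) = -(s / 4) := by push_cast; ring
  rw [e1, Real.exp_neg]
  have hexp : Real.exp (s / 4) ≤ 1 + s := by
    have h3 := Real.one_sub_le_exp_neg (s / 4)
    rw [Real.exp_neg] at h3
    have h4 : 0 < 1 - s / 4 := by linarith
    have h5 : Real.exp (s / 4) ≤ (1 - s / 4)⁻¹ := by
      rw [le_inv_comm₀ (Real.exp_pos _) h4]; exact h3
    refine h5.trans ?_
    rw [inv_le_iff_one_le_mul₀ h4]
    nlinarith
  have hA : 0 < 1 + r ^ 2 - 2 * c := by nlinarith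
  have hA2 : 0 ≤ 1 + r ^ 2 + 2 * c := by nlinarith [sq_nonneg (1 - r)]
  rw [← div_eq_mul_inv, div_div, div_le_div_iff₀ hA (by positivity)]
  calc (1 + r ^ 2 + 2 * c) * ((1 - r) ^ 2 * Real.exp (s / 4))
      ≤ (1 + r ^ 2 + 2 * c) * ((1 - r) ^ 2 * (1 + s)) := by gcongr
    _ ≤ (1 + r) ^ 2 * (1 + r ^ 2 - 2 * c) := by
      have h6 : (1 + r ^ 2 + 2 * c) * (1 - r) ^ 2 ≤ 4 := by
        have : (1 + r ^ 2 + 2 * c) ≤ 4 := by nlinarith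
        have : (1 - r) ^ 2 ≤ 1 := by nlinarith
        nlinarith [sq_nonneg (1 - r)]
      have h7 : (1 + r ^ 2 + 2 * c) * (1 - r) ^ 2 * s ≤ 4 * s := by gcongr
      have h8 : (1 + r) ^ 2 * (1 + r ^ 2 - 2 * c) - (1 + r ^ 2 + 2 * c) * (1 - r) ^ 2
        = 4 * (1 + r ^ 2) * s := by rw [hs]; ring
      nlinarith [mul_nonneg (sq_nonneg r) hs0]

lemma FF_tendsto {q : ℂ} (hq : ‖q‖ < 1) :
    Tendsto (fun k => ∏ i ∈ Finset.range k, ((1 + q ^ (i + 1)) / (1 - q ^ (i + 1)))) atTop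
      (𝓝 (FF q)) := by
  have hq2 : ‖q ^ 2‖ < 1 := by
    rw [norm_pow]; exact pow_lt_one₀ (norm_nonneg _) hq (by simp)
  rw [FF_eq hq]
  refine ((PP_tendsto hq2).div ((PP_tendsto hq).pow 2)
      (pow_ne_zero 2 (PP_ne_zero hq))).congr fun k => ?_
  simp only [Pi.div_apply]
  rw [← Finset.prod_pow, ← Finset.prod_div_distrib]
  apply Finset.prod_congr rfl
  intro i _
  have := one_sub_pow_ne hq i
  field_simp
  ring

lemma FF_bound {q : ℂ} (hq : ‖q‖ < 1) :
    ‖FF q‖ ≤ ‖FF (‖q‖ : ℝ)‖ * Real.exp (-(‖q‖ / (1 - ‖q‖) - (q / (1 - q)).re) / 8) := by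
  set ρ := ‖q‖
  have hρ0 : 0 ≤ ρ := norm_nonneg _
  have hρ : ‖(ρ : ℂ)‖ < 1 := by simpa [abs_of_nonneg hρ0] using hq
  have h1 := (FF_tendsto hq).norm
  have h2 := (FF_tendsto hρ).norm
  have hg : HasSum (fun i : ℕ => ρ ^ (i + 1)) (ρ / (1 - ρ)) := by
    have := (hasSum_geometric_of_lt_one hρ0 hq).mul_left ρ
    simpa [pow_succ', div_eq_mul_inv] using this
  have hg2 : HasSum (fun i : ℕ => (q ^ (i + 1)).re) (q / (1 - q)).re := by
    have := (hasSum_geometric_of_norm_lt_one hq).mul_left q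
    have := Complex.hasSum_re this
    simpa only [pow_succ', div_eq_mul_inv] using this
  have h3 := (hg.sub hg2).tendsto_sum_nat
  have h4 : Tendsto (fun k => Real.exp (-(∑ i ∈ Finset.range k, (ρ ^ (i + 1) - (q ^ (i + 1)).re)) / 8))
      atTop (𝓝 (Real.exp (-(ρ / (1 - ρ) - (q / (1 - q)).re) / 8))) :=
    (Real.continuous_exp.tendsto _).comp (h3.neg.div_const 8)
  refine le_of_tendsto_of_tendsto' h1 (h2.mul h4) fun k => ?_
  rw [norm_prod, norm_prod, neg_div, Finset.sum_div, ← Finset.sum_neg_distrib, Real.exp_sum,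
    ← Finset.prod_mul_distrib]
  apply Finset.prod_le_prod
  · intro i _; positivity
  · intro i _
    have hlt : ‖q ^ (i + 1)‖ < 1 := by
      rw [norm_pow]; exact pow_lt_one₀ (norm_nonneg _) hq (by simp)
    have h5 := ratio_bound hlt
    rw [norm_pow] at h5 hlt
    refine h5.trans (le_of_eq ?_)
    congr 1
    · have : (1 + (ρ : ℂ) ^ (i + 1)) / (1 - (ρ : ℂ) ^ (i + 1)) =
          (((1 + ρ ^ (i + 1)) / (1 - ρ ^ (i + 1)) : ℝ) : ℂ) := by push_cast; rfl
      rw [this, Complex.norm_real, Real.norm_of_nonneg]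
      apply div_nonneg <;> [positivity; linarith]
    · congr 1; ring

end CrankProof

namespace CrankProof
open Filter Topology Complex
open scoped Real

lemma E_lower {x θ : ℝ} (hx : 0 < x) (hx2 : x ≤ 1 / 2) (hθ : |θ| ≤ π) {q : ℂ}
    (hq : q = exp (-(x + θ * I))) :
    ‖q‖ < 1 ∧ ‖q‖ = Real.exp (-x) ∧
    θ ^ 2 / (x * (π ^ 2 * x ^ 2 + 4 * θ ^ 2)) ≤ ‖q‖ / (1 - ‖q‖) - (q / (1 - q)).re := by
  have hnorm : ‖q‖ = Real.exp (-x) := by rw [hq, Complex.norm_exp]; simp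
  have hre : q.re = Real.exp (-x) * Real.cos θ := by rw [hq, Complex.exp_re]; simp
  have hlt : ‖q‖ < 1 := by rw [hnorm, Real.exp_lt_one_iff]; linarith
  refine ⟨hlt, hnorm, ?_⟩
  have hns : q.re ^ 2 + q.im ^ 2 = ‖q‖ ^ 2 := by
    rw [Complex.sq_norm, Complex.normSq_apply]; ring
  rw [← hnorm] at hre
  have hge : 1 / 2 ≤ ‖q‖ := by
    rw [hnorm]; have := Real.one_sub_le_exp_neg x; linarith
  have hδ : 1 - ‖q‖ ≤ x := by
    rw [hnorm]; have := Real.one_sub_le_exp_neg x; linarith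
  have hre2 : (q / (1 - q)).re = (q.re - ‖q‖ ^ 2) / (1 - 2 * q.re + ‖q‖ ^ 2) := by
    rw [Complex.div_re, ← add_div]
    congr 1
    · simp; rw [← hns]; ring
    · rw [Complex.normSq_apply]; simp; rw [← hns]; ring
  set ρ := ‖q‖
  set s := 1 - Real.cos θ with hs
  have hs0 : 2 * θ ^ 2 / π ^ 2 ≤ s := by
    have := Real.cos_le_one_sub_mul_cos_sq hθ
    rw [hs]; have e : 2 * θ ^ 2 / π ^ 2 = 2 / π ^ 2 * θ ^ 2 := by ring
    linarith
  have hs00 : 0 ≤ 2 * θ ^ 2 / π ^ 2 := by positivity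
  have hsp : 0 ≤ s := hs00.trans hs0
  set δ := 1 - ρ with hδd
  have hδ0 : 0 < δ := by linarith
  have hc : q.re = ρ * (1 - s) := by rw [hre, hs]; ring
  have hden : 1 - 2 * q.re + ρ ^ 2 = δ ^ 2 + 2 * ρ * s := by rw [hc, hδd]; ring
  have hnum : q.re - ρ ^ 2 = ρ * δ - ρ * s := by rw [hc, hδd]; ring
  have hρ0 : 0 < ρ := by linarith
  have hE : ρ / δ - (q / (1 - q)).re = ρ * (1 + ρ) * s / (δ * (δ ^ 2 + 2 * ρ * s)) := by
    rw [hre2, hden, hnum]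
    have : 0 < δ ^ 2 + 2 * ρ * s := by positivity
    field_simp
    rw [hδd]; ring
  rw [hE]
  have h1 : s / (2 * x * (x ^ 2 + 2 * s)) ≤ ρ * (1 + ρ) * s / (δ * (δ ^ 2 + 2 * ρ * s)) := by
    have ha : ρ * s ≤ s := by nlinarith
    calc s / (2 * x * (x ^ 2 + 2 * s)) = (1 / 2) * s / (x * (x ^ 2 + 2 * s)) := by
          field_simp
      _ ≤ _ := by
        apply div_le_div₀ (by positivity)
        · gcongr; nlinarith
        · positivity
        · gcongr; linarith
  refine le_trans ?_ h1
  set u := 2 * θ ^ 2 / π ^ 2 with hu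
  have hpi := Real.pi_pos
  have e : θ ^ 2 / (x * (π ^ 2 * x ^ 2 + 4 * θ ^ 2)) = u / (2 * x * (x ^ 2 + 2 * u)) := by
    rw [hu]
    by_cases h0 : θ = 0
    · simp [h0]
    · field_simp; ring
  rw [e, div_le_div_iff₀ (by positivity) (by positivity)]
  have : u * x ^ 3 ≤ s * x ^ 3 := by gcongr
  nlinarith

lemma zt_xt {t : ℝ} (ht : 0 < t) (v : ℝ) : (xt t : ℂ) * zt t v = xt t + ((v / (t * √t) : ℝ) : ℂ) * I := by
  unfold zt xt
  push_cast
  have ht0 : (t : ℂ) ≠ 0 := by exact_mod_cast ht.ne'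
  have hpi : (π : ℂ) ≠ 0 := by exact_mod_cast Real.pi_ne_zero
  have hs0 : ((√t : ℝ) : ℂ) ≠ 0 := by exact_mod_cast (Real.sqrt_pos.2 ht).ne'
  field_simp

lemma GG_le {t v : ℝ} (ht : π ≤ t) (hv : |v| ≤ π * (t * √t)) :
    ‖GG t v‖ ≤ ‖GG t 0‖ * Real.exp (-(t * v ^ 2 / (π * (π ^ 4 * t + 16 * v ^ 2)))) := by
  have hpi := Real.pi_pos
  have ht0 : 0 < t := by linarith
  have hx : 0 < xt t := by unfold xt; positivity
  have hx2 : xt t ≤ 1 / 2 := by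
    unfold xt; rw [div_le_div_iff₀ (by positivity) (by norm_num)]; linarith
  have hst : 0 < √t := Real.sqrt_pos.2 ht0
  have hθ : |v / (t * √t)| ≤ π := by
    rw [abs_div, abs_of_pos (show 0 < t * √t by positivity), div_le_iff₀ (by positivity)]; exact hv
  obtain ⟨h1, h2, h3⟩ := E_lower hx hx2 hθ rfl
  unfold GG
  rw [zt_xt ht0, zt_xt ht0]
  set q := exp (-((xt t : ℂ) + ((v / (t * √t) : ℝ) : ℂ) * I)) with hq
  have h4 := FF_bound h1
  have e1 : exp (-((xt t : ℂ) + ((0 / (t * √t) : ℝ) : ℂ) * I)) = ((‖q‖ : ℝ) : ℂ) := by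
    rw [h2]; push_cast; simp
  rw [e1]
  simp only [norm_mul]
  rw [Complex.norm_exp, Complex.norm_exp]
  have e2 : ∀ y : ℝ, ((-((π * t : ℝ) : ℂ) + ((t ^ 2 : ℝ) : ℂ) * ((xt t : ℂ) + (y : ℂ) * I))).re =
      -(π * t) + t ^ 2 * xt t := by
    intro y
    rw [Complex.add_re, Complex.re_ofReal_mul]; simp
  rw [e2, e2, mul_assoc (‖((√t : ℝ) : ℂ)‖ * _)]
  refine mul_le_mul_of_nonneg_left (h4.trans ?_) (by positivity)
  refine mul_le_mul_of_nonneg_left ?_ (by positivity)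
  apply Real.exp_le_exp.2
  rw [neg_div]
  apply neg_le_neg
  rw [le_div_iff₀ (by norm_num)]
  refine le_trans (le_of_eq ?_) h3
  have hs2 : √t ^ 2 = t := Real.sq_sqrt ht0.le
  unfold xt
  rw [div_pow, mul_pow, hs2]
  by_cases hv0 : v = 0
  · simp [hv0]
  · field_simp
    ring

lemma dom_bound {t v : ℝ} (ht : π ≤ t) (hv : |v| ≤ π * (t * √t)) :
    Real.exp (-(t * v ^ 2 / (π * (π ^ 4 * t + 16 * v ^ 2)))) ≤
      (12 * π ^ 2 * (π * (π ^ 4 + 16)) ^ 3) * (1 + v ^ 2)⁻¹ := by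
  have hpi := Real.pi_pos
  have hpi3 := Real.pi_gt_three
  have ht0 : 0 < t := by linarith
  have ht1 : 1 ≤ t := by linarith
  set k := π * (π ^ 4 + 16) with hk
  have hk0 : 0 < k := by positivity
  have hk1 : 1 ≤ k := by
    have : 1 ≤ π ^ 4 + 16 := by linarith [show 0 < π ^ 4 by positivity]
    nlinarith
  have hk3 : k ≤ k ^ 3 := by
    have : 1 ≤ k ^ 2 := by nlinarith
    nlinarith
  have hv2 : v ^ 2 ≤ π ^ 2 * t ^ 3 := by
    have := pow_le_pow_left₀ (abs_nonneg v) hv 2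
    rw [sq_abs] at this
    refine this.trans (le_of_eq ?_)
    rw [mul_pow, mul_pow, Real.sq_sqrt ht0.le]; ring
  rcases le_total (v ^ 2) t with h | h
  · have h1 : v ^ 2 / k ≤ t * v ^ 2 / (π * (π ^ 4 * t + 16 * v ^ 2)) := by
      calc v ^ 2 / k = t * v ^ 2 / (π * (π ^ 4 * t + 16 * t)) := by rw [hk]; field_simp
        _ ≤ _ := by gcongr
    have h2 : Real.exp (-(t * v ^ 2 / (π * (π ^ 4 * t + 16 * v ^ 2)))) ≤ (1 + v ^ 2 / k)⁻¹ := by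
      rw [Real.exp_neg]
      apply inv_anti₀ (by positivity)
      have := Real.add_one_le_exp (t * v ^ 2 / (π * (π ^ 4 * t + 16 * v ^ 2)))
      linarith
    refine h2.trans ?_
    rw [← div_eq_mul_inv, inv_eq_one_div, div_le_div_iff₀ (by positivity) (by positivity)]
    have h3 : 1 + v ^ 2 ≤ k * (1 + v ^ 2 / k) := by
      rw [mul_add, mul_div_cancel₀ _ hk0.ne']; linarith
    rw [one_mul]
    refine h3.trans ?_
    gcongr
    have hp1 : 1 ≤ 12 * π ^ 2 := by nlinarith
    have hp2 : 1 * k ^ 3 ≤ 12 * π ^ 2 * k ^ 3 := by gcongr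
    linarith
  · have h1 : t / k ≤ t * v ^ 2 / (π * (π ^ 4 * t + 16 * v ^ 2)) := by
      have hvp : 0 < v ^ 2 := by linarith
      have hv0 : v ≠ 0 := by rintro rfl; simp at hvp
      calc t / k = t * v ^ 2 / (π * (π ^ 4 * v ^ 2 + 16 * v ^ 2)) := by rw [hk]; field_simp
        _ ≤ _ := by gcongr
    have h2 : Real.exp (-(t * v ^ 2 / (π * (π ^ 4 * t + 16 * v ^ 2)))) ≤ ((t / k) ^ 3 / 6)⁻¹ := by
      rw [Real.exp_neg]
      apply inv_anti₀ (by positivity)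
      have h5 := Real.pow_div_factorial_le_exp (t / k) (by positivity) 3
      have h6 := Real.exp_le_exp.2 h1
      have e6 : ((Nat.factorial 3 : ℕ) : ℝ) = 6 := by norm_num [Nat.factorial]
      rw [e6] at h5
      exact h5.trans h6
    refine h2.trans ?_
    rw [← div_eq_mul_inv, inv_eq_one_div, div_le_div_iff₀ (by positivity) (by positivity)]
    have h7 : 1 + v ^ 2 ≤ 2 * (π ^ 2 * t ^ 3) := by linarith
    calc 1 * (1 + v ^ 2) ≤ 2 * (π ^ 2 * t ^ 3) := by linarith
      _ = _ := by field_simp; norm_num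

end CrankProof

namespace CrankProof
open Filter Topology Complex MeasureTheory
open scoped Real

lemma int_exp (n k : ℕ) : ∫ θ in (-π)..π, exp (((n : ℂ) - k) * (θ * I)) = if k = n then ((2 * π : ℝ) : ℂ) else 0 := by
  by_cases h : k = n
  · subst h; simp; ring
  · rw [if_neg h]
    have hc : ((n : ℂ) - k) * I ≠ 0 := by
      refine mul_ne_zero (sub_ne_zero.2 ?_) I_ne_zero
      have h' : n ≠ k := fun e => h e.symm
      exact_mod_cast h'
    have e : ∀ θ : ℝ, exp (((n : ℂ) - k) * (θ * I)) = exp ((((n : ℂ) - k) * I) * θ) := by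
      intro θ; congr 1; ring
    simp_rw [e]
    rw [integral_exp_mul_complex hc]
    have : exp ((((n : ℂ) - k) * I) * (π : ℝ)) = exp ((((n : ℂ) - k) * I) * (-π : ℝ)) := by
      rw [Complex.exp_eq_exp_iff_exists_int]
      refine ⟨(n : ℤ) - k, ?_⟩
      push_cast; ring
    rw [this, sub_self, zero_div]

lemma pb_int (n : ℕ) {x : ℝ} (hx : 0 < x) :
    ∫ θ in (-π)..π, exp ((n : ℂ) * (x + θ * I)) * FF (exp (-(x + θ * I))) = ((2 * π * pb n : ℝ) : ℂ) := by
  have hq : ∀ θ : ℝ, ‖exp (-((x : ℂ) + θ * I))‖ = Real.exp (-x) := by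
    intro θ; rw [Complex.norm_exp]; simp
  have hlt : Real.exp (-x) < 1 := by rw [Real.exp_lt_one_iff]; linarith
  have key : HasSum (fun k : ℕ => ∫ θ in (-π)..π, exp ((n : ℂ) * (x + θ * I)) * ((pb k : ℂ) * exp (-(x + θ * I)) ^ k))
      (∫ θ in (-π)..π, exp ((n : ℂ) * (x + θ * I)) * FF (exp (-(x + θ * I)))) := by
    apply intervalIntegral.hasSum_integral_of_dominated_convergence
      (fun k _ => Real.exp (n * x) * ((pb k : ℝ) * Real.exp (-x) ^ k))
    · intro k
      apply Continuous.aestronglyMeasurable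
      fun_prop
    · intro k
      refine Eventually.of_forall fun θ _ => ?_
      rw [norm_mul, norm_mul, norm_pow, hq, Complex.norm_exp]
      simp
    · refine Eventually.of_forall fun θ _ => ?_
      exact (summable_pb (Real.exp_pos _).le hlt).mul_left _
    · apply intervalIntegrable_const
    · refine Eventually.of_forall fun θ _ => ?_
      apply HasSum.mul_left
      exact (summable_pbC (by rw [hq]; exact hlt)).hasSum
  have e : ∀ k : ℕ, (∫ θ in (-π)..π, exp ((n : ℂ) * (x + θ * I)) * ((pb k : ℂ) * exp (-(x + θ * I)) ^ k))
      = if k = n then ((2 * π * pb n : ℝ) : ℂ) else 0 := by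
    intro k
    have e1 : ∀ θ : ℝ, exp ((n : ℂ) * (x + θ * I)) * ((pb k : ℂ) * exp (-(x + θ * I)) ^ k) =
        ((pb k : ℂ) * exp (((n : ℂ) - k) * x)) * exp (((n : ℂ) - k) * (θ * I)) := by
      intro θ
      rw [← Complex.exp_nat_mul, mul_left_comm, ← Complex.exp_add, mul_assoc, ← Complex.exp_add]
      congr 2; ring
    simp_rw [e1]
    rw [intervalIntegral.integral_const_mul, int_exp]
    by_cases h : k = n
    · subst h; simp; ring
    · simp [h]
  simp_rw [e] at key
  exact key.unique (hasSum_ite_eq n _)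

lemma GG_int (n : ℕ) (hn : 1 ≤ n) :
    ∫ v in (-(π * (√n * √(√n))))..(π * (√n * √(√n))), GG (√n) v =
      ((2 * π * (n * Real.exp (-(π * √n)) * pb n) : ℝ) : ℂ) := by
  set t := √(n : ℝ) with ht
  have hn0 : (0 : ℝ) < n := by exact_mod_cast hn
  have ht0 : 0 < t := Real.sqrt_pos.2 hn0
  have ht2 : t ^ 2 = n := Real.sq_sqrt hn0.le
  have hs0 : 0 < √t := Real.sqrt_pos.2 ht0
  have hs2 : √t * √t = t := Real.mul_self_sqrt ht0.le
  have hx : 0 < xt t := by unfold xt; positivity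
  have e1 : ∀ v : ℝ, GG t v = ((√t * Real.exp (-(π * t)) : ℝ) : ℂ) * (fun θ : ℝ => exp ((n : ℂ) * (xt t + θ * I)) * FF (exp (-(xt t + θ * I)))) (v / (t * √t)) := by
    intro v
    unfold GG
    rw [zt_xt ht0, ht2, Complex.exp_add]
    push_cast
    ring
  simp_rw [e1]
  rw [intervalIntegral.integral_const_mul, intervalIntegral.integral_comp_div
    (fun θ : ℝ => exp ((n : ℂ) * (xt t + θ * I)) * FF (exp (-(xt t + θ * I)))) (by positivity)]
  rw [show -(π * (t * √t)) / (t * √t) = -π by field_simp, show (π * (t * √t)) / (t * √t) = π by field_simp]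
  rw [pb_int n hx]
  rw [Complex.real_smul, ← Complex.ofReal_mul, ← Complex.ofReal_mul]
  congr 1
  rw [← ht2]
  linear_combination (Real.exp (-(π*t)) * t * 2 * π * pb n) * hs2

lemma FF_cont : ContinuousOn FF (Metric.ball 0 1) := FF_diff.continuousOn

lemma GG_cont {t : ℝ} (ht : 0 < t) : Continuous (GG t) := by
  have hx : 0 < xt t := by unfold xt; have := Real.pi_pos; positivity
  have h1 : Continuous (fun v : ℝ => exp (-((xt t : ℂ) * zt t v))) := by
    unfold zt; fun_prop
  have h2 : Continuous (fun v : ℝ => FF (exp (-((xt t : ℂ) * zt t v)))) := by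
    refine FF_cont.comp_continuous h1 fun v => ?_
    rw [mem_ball_zero_iff, zt_xt ht, Complex.norm_exp, Real.exp_lt_one_iff]
    rw [Complex.neg_re, Complex.add_re, Complex.re_ofReal_mul]
    simpa using hx
  have h3 : Continuous (fun v : ℝ => zt t v) := by unfold zt; fun_prop
  unfold GG
  fun_prop

lemma pb_asymp : Tendsto (fun n : ℕ => 8 * (n : ℝ) * Real.exp (-(π * √n)) * pb n) atTop (𝓝 1) := by
  have hpi := Real.pi_pos
  have ht : Tendsto (fun n : ℕ => √(n : ℝ)) atTop atTop :=
    Real.tendsto_sqrt_atTop.comp tendsto_natCast_atTop_atTop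
  have h0 : ∀ᶠ t in atTop, ‖GG t 0‖ ≤ 1 := by
    have h := (GG_lim 0).norm
    refine (h.eventually_lt_const ?_).mono fun t h => h.le
    rw [Complex.norm_real, Real.norm_eq_abs]
    simp
    rw [abs_of_nonneg (by positivity)]
    have : 1 < √2 := by rw [Real.lt_sqrt] <;> norm_num
    have h3 := inv_lt_one_of_one_lt₀ this
    have : 0 < (√2)⁻¹ := by positivity
    linarith
  set C := 12 * π ^ 2 * (π * (π ^ 4 + 16)) ^ 3 with hC
  have key : Tendsto (fun n : ℕ => ∫ v : ℝ, (Set.Ioc (-(π * (√n * √(√n)))) (π * (√n * √(√n)))).indicator (GG (√n)) v)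
      atTop (𝓝 (∫ v : ℝ, ((1/(2*√2) * Real.exp (-(2/π)*v^2) : ℝ) : ℂ))) := by
    apply tendsto_integral_filter_of_dominated_convergence (fun v => C * (1 + v ^ 2)⁻¹)
    · filter_upwards [eventually_ge_atTop 1] with n hn
      have : 0 < √(n : ℝ) := Real.sqrt_pos.2 (by exact_mod_cast hn)
      exact ((GG_cont this).aestronglyMeasurable).indicator measurableSet_Ioc
    · filter_upwards [ht.eventually h0, ht.eventually (eventually_ge_atTop π)] with n h1 h2
      refine Eventually.of_forall fun v => ?_
      have hCp : 0 ≤ C * (1 + v ^ 2)⁻¹ := by positivity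
      rw [norm_indicator_eq_indicator_norm]
      by_cases hv : v ∈ Set.Ioc (-(π * (√n * √(√n)))) (π * (√n * √(√n)))
      · rw [Set.indicator_of_mem hv]
        have hv : |v| ≤ π * (√n * √(√n)) := abs_le.2 ⟨hv.1.le, hv.2⟩
        refine (GG_le h2 hv).trans ?_
        have h3 := dom_bound h2 hv
        calc _ ≤ 1 * _ := mul_le_mul_of_nonneg_right h1 (Real.exp_pos _).le
          _ ≤ _ := by rw [one_mul]; exact h3
      · rw [Set.indicator_of_notMem hv]; exact hCp
    · exact integrable_inv_one_add_sq.const_mul C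
    · refine Eventually.of_forall fun v => ?_
      refine ((GG_lim v).comp ht).congr' ?_
      have hb : Tendsto (fun n : ℕ => π * (√(n : ℝ) * √(√n))) atTop atTop :=
        (ht.atTop_mul_atTop₀ (Real.tendsto_sqrt_atTop.comp ht)).const_mul_atTop hpi
      filter_upwards [hb.eventually (eventually_gt_atTop |v|)] with n hn
      rw [Set.indicator_of_mem]
      · rfl
      · have := abs_lt.1 hn
        exact ⟨this.1, this.2.le⟩
  have e2 : (∫ v : ℝ, ((1/(2*√2) * Real.exp (-(2/π)*v^2) : ℝ) : ℂ)) = ((π / 4 : ℝ) : ℂ) := by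
    rw [integral_complex_ofReal, integral_const_mul, integral_gaussian]
    congr 1
    rw [show π / (2 / π) = (π / √2) ^ 2 by rw [div_pow, Real.sq_sqrt (by norm_num)]; field_simp,
      Real.sqrt_sq (by positivity)]
    have : √2 * √2 = 2 := Real.mul_self_sqrt (by norm_num)
    have h2 : √2 ≠ 0 := by positivity
    field_simp
    nlinarith
  rw [e2] at key
  have key2 := (Complex.continuous_re.tendsto _).comp key
  have key3 := key2.const_mul (4 / π)
  rw [Complex.ofReal_re, show 4 / π * (π / 4) = 1 by field_simp] at key3
  refine key3.congr' ?_
  filter_upwards [eventually_ge_atTop 1] with n hn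
  have h := GG_int n hn
  have hle : -(π * (√(n:ℝ) * √(√n))) ≤ π * (√(n:ℝ) * √(√n)) := by
    have : 0 ≤ π * (√(n:ℝ) * √(√n)) := by positivity
    linarith
  rw [intervalIntegral.integral_of_le hle] at h
  simp only [Function.comp]
  rw [integral_indicator measurableSet_Ioc, h, Complex.ofReal_re]
  field_simp
  ring

end CrankProof

namespace CrankProof
open Filter Topology MeasureTheory
open scoped Real

/-- Shifted overpartition counting function. -/
noncomputable def sh (N j : ℕ) : ℝ := if j ≤ N then (pb (N - j) : ℝ) else 0

lemma sh_nonneg (N j : ℕ) : 0 ≤ sh N j := by unfold sh; split_ifs <;> positivity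

lemma pb_pos (n : ℕ) : 1 ≤ pb n := by
  unfold pb opc
  refine Nat.one_le_iff_ne_zero.2 (Nat.card_pos_iff.2 ⟨⟨⟨⟨∅, Multiset.replicate n 1, by simp, ?a, by simp⟩, ?b⟩⟩, ?c⟩).ne'
  case a =>
    intro i hi
    rw [Multiset.eq_of_mem_replicate hi]; norm_num
  case c => infer_instance
  case b =>
    intro i hi
    rw [Multiset.eq_of_mem_replicate hi]; norm_num

/-- Normalised count. -/
noncomputable def nb (n : ℕ) : ℝ := (n + 1) * Real.exp (-(π * √n)) * pb n

lemma nb_tendsto : Tendsto nb atTop (𝓝 (1 / 8)) := by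
  have h1 : Tendsto (fun n : ℕ => ((n : ℝ) + 1) / n) atTop (𝓝 1) := by
    have h := (tendsto_const_nhds (x := (1 : ℝ))).add (tendsto_one_div_atTop_nhds_zero_nat (𝕜 := ℝ))
    rw [add_zero] at h
    refine h.congr' ?_
    filter_upwards [eventually_ge_atTop 1] with n hn
    have : (n : ℝ) ≠ 0 := by positivity
    field_simp
  have h2 := (h1.mul pb_asymp).mul_const (1 / 8)
  simp only [one_mul] at h2
  refine h2.congr' ?_
  filter_upwards [eventually_ge_atTop 1] with n hn
  have : (n : ℝ) ≠ 0 := by positivity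
  unfold nb
  field_simp

lemma nb_pos (n : ℕ) : 0 < nb n := by
  have : (1 : ℝ) ≤ pb n := by exact_mod_cast pb_pos n
  unfold nb
  have := Real.exp_pos (-(π * √n))
  positivity

lemma nb_upper : ∃ C : ℝ, 0 < C ∧ ∀ n, nb n ≤ C := by
  obtain ⟨C, hC⟩ := nb_tendsto.bddAbove_range
  refine ⟨max C 1, by positivity, fun n => (hC ⟨n, rfl⟩).trans (le_max_left _ _)⟩

lemma nb_lower : ∃ c : ℝ, 0 < c ∧ ∀ n, c ≤ nb n := by
  have h := nb_tendsto.inv₀ (by norm_num)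
  obtain ⟨C, hC⟩ := h.bddAbove_range
  refine ⟨(max C 1)⁻¹, by positivity, fun n => ?_⟩
  have h1 : (nb n)⁻¹ ≤ max C 1 := (hC ⟨n, rfl⟩).trans (le_max_left _ _)
  exact inv_le_of_inv_le₀ (nb_pos n) h1

lemma pb_eq (n : ℕ) : (pb n : ℝ) = nb n * Real.exp (π * √n) / (n + 1) := by
  unfold nb
  have h : Real.exp (-(π * √n)) * Real.exp (π * √n) = 1 := by rw [← Real.exp_add]; simp
  have : (n : ℝ) + 1 ≠ 0 := by positivity
  field_simp
  linear_combination (-(pb n : ℝ)) * h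

lemma sqrt_diff {N j : ℕ} (hj : j ≤ N) (hN : 1 ≤ N) : √((N - j : ℕ) : ℝ) ≤ √N - j / (2 * √N) := by
  have hN0 : (0 : ℝ) < N := by exact_mod_cast hN
  have hs : 0 < √(N : ℝ) := Real.sqrt_pos.2 hN0
  have hs2 : √(N : ℝ) ^ 2 = N := Real.sq_sqrt hN0.le
  have hj' : (j : ℝ) ≤ N := by exact_mod_cast hj
  rw [Nat.cast_sub hj]
  apply Real.sqrt_le_iff.2
  constructor
  · rw [sub_nonneg, div_le_iff₀ (by positivity)]; nlinarith
  · have : (√(N:ℝ) - j / (2 * √N)) ^ 2 = N - j + (j / (2 * √N)) ^ 2 := by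
      rw [sub_sq, hs2]; field_simp
    rw [this]; nlinarith [sq_nonneg ((j : ℝ) / (2 * √N))]

lemma sh_bound : ∃ C : ℝ, 0 < C ∧ ∀ N j : ℕ, 1 ≤ N →
    sh N j ≤ C * pb N * Real.exp (-(π / 4 * (j / √N))) := by
  obtain ⟨C, hC, hCn⟩ := nb_upper
  obtain ⟨c, hc, hcn⟩ := nb_lower
  refine ⟨C / c * 33, by positivity, fun N j hN => ?_⟩
  unfold sh
  split_ifs with hj
  swap
  · positivity
  have hpi := Real.pi_pos
  have hpi3 := Real.pi_gt_three
  have hN0 : (0 : ℝ) < N := by exact_mod_cast hN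
  have hs : 0 < √(N : ℝ) := Real.sqrt_pos.2 hN0
  have hs2 : √(N : ℝ) ^ 2 = N := Real.sq_sqrt hN0.le
  have hj' : (j : ℝ) ≤ N := by exact_mod_cast hj
  have hd := sqrt_diff hj hN
  rw [pb_eq, pb_eq]
  have hM : ((N - j : ℕ) : ℝ) = N - j := Nat.cast_sub hj
  have hM0 : (0 : ℝ) < ((N - j : ℕ) : ℝ) + 1 := by positivity
  -- rational factor
  have key : ((N : ℝ) + 1) ≤ 33 * (((N - j : ℕ) : ℝ) + 1) * Real.exp (π / 4 * (j / √N)) := by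
    rcases le_total ((j : ℝ)) (N / 2) with h | h
    · have h1 : 1 ≤ Real.exp (π / 4 * (j / √N)) := Real.one_le_exp (by positivity)
      have h2 : (N : ℝ) + 1 ≤ 33 * (((N - j : ℕ) : ℝ) + 1) := by rw [hM]; linarith
      nlinarith
    · have h1 : 1 ≤ ((N - j : ℕ) : ℝ) + 1 := by
        have : (0:ℝ) ≤ ((N - j : ℕ) : ℝ) := by positivity
        linarith
      have h2 : √(N : ℝ) / 4 ≤ π / 4 * (j / √N) := by
        have : √(N : ℝ) / 2 ≤ j / √N := by rw [le_div_iff₀ hs]; nlinarith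
        nlinarith
      have h3 := Real.pow_div_factorial_le_exp (√(N : ℝ) / 4) (by positivity) 2
      have h4 := Real.exp_le_exp.2 h2
      have h5 := Real.add_one_le_exp (√(N : ℝ) / 4)
      have e2 : ((Nat.factorial 2 : ℕ) : ℝ) = 2 := by norm_num [Nat.factorial]
      rw [e2, div_pow, hs2] at h3
      have h6 : 1 * Real.exp (π / 4 * (j / √N)) ≤ (((N - j : ℕ) : ℝ) + 1) * Real.exp (π / 4 * (j / √N)) := by
        gcongr
      have h7 : 0 < √(N : ℝ) / 4 := by positivity
      linarith
  calc nb (N - j) * Real.exp (π * √((N - j : ℕ) : ℝ)) / (((N - j : ℕ) : ℝ) + 1)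
      ≤ C * Real.exp (π * (√N - j / (2 * √N))) / (((N - j : ℕ) : ℝ) + 1) := by
        gcongr; exact hCn _
    _ ≤ C * Real.exp (π * (√N - j / (2 * √N))) * (33 * Real.exp (π / 4 * (j / √N)) / (N + 1)) := by
        rw [div_eq_mul_inv]
        refine mul_le_mul_of_nonneg_left ?_ (by positivity)
        rw [inv_eq_one_div, div_le_div_iff₀ (by positivity) (by positivity)]
        linarith
    _ = C / c * 33 * (c * Real.exp (π * √N) / (N + 1)) * Real.exp (-(π / 4 * (j / √N))) := by
        have : Real.exp (π * (√N - j / (2 * √N))) * Real.exp (π / 4 * (j / √N)) =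
            Real.exp (π * √N) * Real.exp (-(π / 4 * (j / √N))) := by
          rw [← Real.exp_add, ← Real.exp_add]; congr 1; field_simp; ring
        calc _ = C * 33 / (N + 1) * (Real.exp (π * (√N - j / (2 * √N))) * Real.exp (π / 4 * (j / √N))) := by ring
          _ = _ := by rw [this]; field_simp
    _ ≤ _ := by gcongr; exact hcn _

lemma sh_lim {j : ℕ → ℕ} {y : ℝ} (h : Tendsto (fun N : ℕ => (j N : ℝ) / √N) atTop (𝓝 y)) :
    Tendsto (fun N : ℕ => sh N (j N) / pb N) atTop (𝓝 (Real.exp (-(π / 2 * y)))) := by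
  have hsq : Tendsto (fun n : ℕ => √(n : ℝ)) atTop atTop :=
    Real.tendsto_sqrt_atTop.comp tendsto_natCast_atTop_atTop
  have hinv : Tendsto (fun n : ℕ => (√(n : ℝ))⁻¹) atTop (𝓝 0) := tendsto_inv_atTop_zero.comp hsq
  -- j / N tends to zero
  have h0 : Tendsto (fun N : ℕ => (j N : ℝ) / N) atTop (𝓝 0) := by
    have := h.mul hinv
    rw [mul_zero] at this
    refine this.congr fun N => ?_
    rw [div_eq_mul_inv, mul_assoc, ← mul_inv, Real.mul_self_sqrt (by positivity), ← div_eq_mul_inv]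
  have hle : ∀ᶠ N in atTop, j N ≤ N := by
    filter_upwards [h0.eventually_lt_const (show (0:ℝ) < 1 by norm_num), eventually_ge_atTop 1] with N hN h1
    have hN0 : (0 : ℝ) < N := by exact_mod_cast h1
    rw [div_lt_one hN0] at hN
    exact_mod_cast hN.le
  have hM : Tendsto (fun N : ℕ => N - j N) atTop atTop := by
    rw [← tendsto_natCast_atTop_iff (R := ℝ)]
    refine tendsto_atTop_mono' atTop ?_ ((tendsto_natCast_atTop_atTop (R := ℝ)).atTop_div_const (show (0:ℝ) < 2 by norm_num))
    filter_upwards [h0.eventually_lt_const (show (0:ℝ) < 1 / 2 by norm_num), hle, eventually_ge_atTop 1] with N hN hl h1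
    have hN0 : (0 : ℝ) < N := by exact_mod_cast h1
    rw [div_lt_iff₀ hN0] at hN
    rw [Nat.cast_sub hl]; linarith
  have l1 : Tendsto (fun N => nb (N - j N) / nb N) atTop (𝓝 1) := by
    have := (nb_tendsto.comp hM).div nb_tendsto (by norm_num)
    rwa [div_self (by norm_num)] at this
  have l2 : Tendsto (fun N : ℕ => (1 - (j N : ℝ) / (N + 1))⁻¹) atTop (𝓝 1) := by
    have : Tendsto (fun N : ℕ => (j N : ℝ) / (N + 1)) atTop (𝓝 0) := by
      refine squeeze_zero' (Eventually.of_forall fun N => by positivity) ?_ h0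
      filter_upwards [eventually_ge_atTop 1] with N h1
      have hN0 : (0 : ℝ) < N := by exact_mod_cast h1
      gcongr; linarith
    have h2 := (tendsto_const_nhds (x := (1 : ℝ))).sub this
    rw [sub_zero] at h2
    simpa using h2.inv₀ one_ne_zero
  have l3 : Tendsto (fun N : ℕ => Real.exp (-(π * ((j N : ℝ) / √N / (1 + √(1 - j N / N)))))) atTop
      (𝓝 (Real.exp (-(π / 2 * y)))) := by
    have h2 := (tendsto_const_nhds (x := (1 : ℝ))).sub h0
    have h3 := (tendsto_const_nhds (x := (1 : ℝ))).add ((Real.continuous_sqrt.tendsto _).comp h2)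
    have h4 := h.div h3 (by positivity)
    have h5 := (h4.const_mul π).neg
    have h6 := (Real.continuous_exp.tendsto _).comp h5
    have e : Real.exp (-(π * (y / (1 + √(1 - 0))))) = Real.exp (-(π / 2 * y)) := by
      congr 1; rw [sub_zero, Real.sqrt_one]; ring
    rw [e] at h6
    exact h6
  have l4 := (l1.mul l2).mul l3
  rw [one_mul, one_mul] at l4
  refine l4.congr' ?_
  filter_upwards [hle, eventually_ge_atTop 1] with N hl h1
  have hN0 : (0 : ℝ) < N := by exact_mod_cast h1
  have hs : 0 < √(N : ℝ) := Real.sqrt_pos.2 hN0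
  have hs2 : √(N : ℝ) ^ 2 = N := Real.sq_sqrt hN0.le
  have hj' : (j N : ℝ) ≤ N := by exact_mod_cast hl
  have hd0 : (0 : ℝ) ≤ 1 - j N / N := by
    rw [sub_nonneg, div_le_one hN0]; exact hj'
  have e1 : √((N - j N : ℕ) : ℝ) = √N * √(1 - j N / N) := by
    rw [← Real.sqrt_mul hN0.le, Nat.cast_sub hl]; congr 1; field_simp
  have e2 : -(π * ((j N : ℝ) / √N / (1 + √(1 - j N / N)))) = π * √((N - j N : ℕ) : ℝ) - π * √N := by
    rw [e1]
    have hq : √(1 - (j N : ℝ) / N) ^ 2 = 1 - j N / N := Real.sq_sqrt hd0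
    set w := √(1 - (j N : ℝ) / N)
    have hw : 0 ≤ w := Real.sqrt_nonneg _
    have hw1 : 1 + w ≠ 0 := by positivity
    have e3 : (j N : ℝ) = N * (1 - w ^ 2) := by rw [hq]; field_simp; ring
    have e4 : (j N : ℝ) / √N = √N * (1 - w ^ 2) := by
      rw [div_eq_iff hs.ne', e3]; linear_combination (-(1 - w ^ 2)) * hs2
    rw [e4]
    field_simp
    ring
  rw [e2, Real.exp_sub]
  have hb : sh N (j N) = pb (N - j N) := by unfold sh; rw [if_pos hl]
  rw [hb, pb_eq, pb_eq, Nat.cast_sub hl]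
  have := (nb_pos N).ne'
  have := (Real.exp_pos (π * √N)).ne'
  have h6 : (1 - (j N : ℝ) / (N + 1))⁻¹ = (N + 1) / (N - j N + 1) := by
    have : (N : ℝ) - j N + 1 ≠ 0 := by linarith
    have h8 : (1 - (j N : ℝ) / (N + 1)) = (N - j N + 1) / (N + 1) := by field_simp; ring
    rw [h8, inv_div]
  rw [h6]
  have : (N : ℝ) - j N + 1 ≠ 0 := by linarith
  field_simp

end CrankProof

namespace CrankProof
open Filter Topology MeasureTheory
open scoped Real

lemma sum_eq_int (r : ℕ) (hr : 1 ≤ r) (h : ℕ → ℝ) (N : ℕ) :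
    ∑ m ∈ Finset.range N, (((m : ℝ) + 1) ^ r - (m : ℝ) ^ r) * h (m + 1) =
      ∫ t in (0 : ℝ)..N, r * t ^ (r - 1) * h ⌈t⌉₊ := by
  have hae : ∀ m : ℕ, ∀ t ∈ Set.uIoc (m : ℝ) ((m + 1 : ℕ) : ℝ), 
      r * t ^ (r - 1) * h (m + 1) = r * t ^ (r - 1) * h ⌈t⌉₊ := by
    intro m t ht
    rw [Set.uIoc_of_le (by push_cast; linarith)] at ht
    have : ⌈t⌉₊ = m + 1 := by
      rw [Nat.ceil_eq_iff (by omega)]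
      simpa using ht
    rw [this]
  have hinteg : ∀ m < N, IntervalIntegrable (fun t : ℝ => r * t ^ (r - 1) * h ⌈t⌉₊) volume (m : ℝ) ((m + 1 : ℕ) : ℝ) := by
    intro m _
    have : IntervalIntegrable (fun t : ℝ => r * t ^ (r - 1) * h (m + 1)) volume (m : ℝ) ((m + 1 : ℕ) : ℝ) := by
      apply Continuous.intervalIntegrable; fun_prop
    exact this.congr (hae m)
  have hs := intervalIntegral.sum_integral_adjacent_intervals (a := fun k : ℕ => (k : ℝ)) hinteg
  simp only [Nat.cast_zero] at hs
  rw [← hs]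
  refine Finset.sum_congr rfl fun m _ => ?_
  rw [← intervalIntegral.integral_congr_ae (Eventually.of_forall (hae m))]
  rw [intervalIntegral.integral_mul_const, intervalIntegral.integral_const_mul, integral_pow]
  congr 1
  have h1 : r - 1 + 1 = r := by omega
  have h2 : ((r - 1 : ℕ) : ℝ) + 1 = r := by exact_mod_cast h1
  rw [h1, h2]
  have : (r : ℝ) ≠ 0 := by positivity
  field_simp
  push_cast; ring

/-- Exponent shift. -/
def JJ (k m : ℕ) : ℕ := (k + 1).choose 2 + (k + 1) * m

noncomputable def TT (r k N : ℕ) : ℝ :=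
  ∑ m ∈ Finset.range N, (((m : ℝ) + 1) ^ r - (m : ℝ) ^ r) * sh N (JJ k (m + 1))

lemma TT_eq (r k N : ℕ) (hr : 1 ≤ r) (hN : 1 ≤ N) :
    TT r k N / (pb N * √N ^ r) =
      ∫ u in Set.Ioi (0 : ℝ), (Set.Iic (√N)).indicator
        (fun u => r * u ^ (r - 1) * (sh N (JJ k ⌈√N * u⌉₊) / pb N)) u := by
  have hN0 : (0 : ℝ) < N := by exact_mod_cast hN
  have hs : 0 < √(N : ℝ) := Real.sqrt_pos.2 hN0
  have hs2 : √(N : ℝ) * √N = N := Real.mul_self_sqrt hN0.le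
  have hp : (0 : ℝ) < pb N := by exact_mod_cast pb_pos N
  rw [setIntegral_indicator measurableSet_Iic, Set.Ioi_inter_Iic, ← intervalIntegral.integral_of_le hs.le]
  unfold TT
  rw [sum_eq_int r hr (fun j => sh N (JJ k j))]
  have h := intervalIntegral.integral_comp_mul_left (a := 0) (b := √(N : ℝ)) (fun t : ℝ => r * t ^ (r - 1) * sh N (JJ k ⌈t⌉₊)) hs.ne'
  rw [mul_zero, hs2] at h
  have e1 : ∀ u : ℝ, r * u ^ (r - 1) * (sh N (JJ k ⌈√N * u⌉₊) / pb N) =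
      (√N ^ (r - 1) * pb N)⁻¹ * (r * (√N * u) ^ (r - 1) * sh N (JJ k ⌈√N * u⌉₊)) := by
    intro u; rw [mul_pow]; field_simp
  simp_rw [e1]
  rw [intervalIntegral.integral_const_mul, h, smul_eq_mul]
  obtain ⟨s, rfl⟩ : ∃ s, r = s + 1 := ⟨r - 1, by omega⟩
  simp only [Nat.add_sub_cancel, pow_succ]
  field_simp

lemma dom_int (r : ℕ) (hr : 1 ≤ r) {b : ℝ} (hb : 0 < b) :
    IntegrableOn (fun u : ℝ => u ^ (r - 1) * Real.exp (-(b * u))) (Set.Ioi 0) ∧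
    ∫ u in Set.Ioi (0 : ℝ), u ^ (r - 1) * Real.exp (-(b * u)) = (1 / b) ^ r * (r - 1).factorial := by
  have e : ∀ u ∈ Set.Ioi (0 : ℝ), u ^ ((r : ℝ) - 1) * Real.exp (-(b * u)) = u ^ (r - 1) * Real.exp (-(b * u)) := by
    intro u _
    congr 1
    rw [← Real.rpow_natCast]; congr 1; push_cast [hr]; ring
  have h1 := Real.integral_rpow_mul_exp_neg_mul_Ioi (a := (r : ℝ)) (by positivity) hb
  rw [setIntegral_congr_fun measurableSet_Ioi e] at h1
  constructor
  · have h2 := integrableOn_rpow_mul_exp_neg_mul_rpow (s := (r : ℝ) - 1) (p := 1) (b := b)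
      (by have : (0:ℝ) < r := by positivity
          linarith) one_pos hb
    refine h2.congr_fun (fun u hu => ?_) measurableSet_Ioi
    rw [← e u hu]; simp
  · rw [h1, Real.rpow_natCast]
    congr 1
    obtain ⟨s, rfl⟩ : ∃ s, r = s + 1 := ⟨r - 1, by omega⟩
    push_cast
    rw [Real.Gamma_nat_eq_factorial]

lemma TT_lim (r k : ℕ) (hr : 1 ≤ r) :
    Tendsto (fun N => TT r k N / (pb N * √N ^ r)) atTop (𝓝 (r.factorial * (2 / (π * (k + 1))) ^ r)) := by
  have hpi := Real.pi_pos
  obtain ⟨C, hC, hCb⟩ := sh_bound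
  have hsq : Tendsto (fun n : ℕ => √(n : ℝ)) atTop atTop :=
    Real.tendsto_sqrt_atTop.comp tendsto_natCast_atTop_atTop
  have hinv : Tendsto (fun n : ℕ => (√(n : ℝ))⁻¹) atTop (𝓝 0) := tendsto_inv_atTop_zero.comp hsq
  have key : Tendsto (fun N : ℕ => ∫ u in Set.Ioi (0 : ℝ), (Set.Iic (√N)).indicator
        (fun u => r * u ^ (r - 1) * (sh N (JJ k ⌈√N * u⌉₊) / pb N)) u) atTop
      (𝓝 (∫ u in Set.Ioi (0 : ℝ), r * u ^ (r - 1) * Real.exp (-(π / 2 * ((k + 1) * u))))) := by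
    apply tendsto_integral_filter_of_dominated_convergence
      (fun u => (r * C) * (u ^ (r - 1) * Real.exp (-(π / 4 * u))))
    · refine Eventually.of_forall fun N => ?_
      apply Measurable.aestronglyMeasurable
      apply Measurable.indicator _ measurableSet_Iic
      have : Measurable (fun u : ℝ => sh N (JJ k ⌈√N * u⌉₊)) := by
        have h1 : Measurable (fun j : ℕ => sh N (JJ k j)) := measurable_from_top
        exact h1.comp (Nat.measurable_ceil.comp (by fun_prop))
      fun_prop
    · filter_upwards [eventually_ge_atTop 1] with N hN
      rw [ae_restrict_iff' measurableSet_Ioi]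
      refine Eventually.of_forall fun u hu => ?_
      have hu0 : (0 : ℝ) < u := hu
      have hN0 : (0 : ℝ) < N := by exact_mod_cast hN
      have hs : 0 < √(N : ℝ) := Real.sqrt_pos.2 hN0
      have hp : (0 : ℝ) < pb N := by exact_mod_cast pb_pos N
      have hb : 0 ≤ (r * C) * (u ^ (r - 1) * Real.exp (-(π / 4 * u))) := by positivity
      rw [norm_indicator_eq_indicator_norm]
      by_cases hv : u ∈ Set.Iic (√N : ℝ)
      · rw [Set.indicator_of_mem hv, Real.norm_of_nonneg
          (by have := sh_nonneg N (JJ k ⌈√N * u⌉₊); positivity)]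
        have h1 := hCb N (JJ k ⌈√N * u⌉₊) hN
        have h2 : u ≤ (JJ k ⌈√N * u⌉₊ : ℕ) / √N := by
          rw [le_div_iff₀ hs]
          have h3 : ⌈√N * u⌉₊ ≤ JJ k ⌈√N * u⌉₊ := by unfold JJ; nlinarith
          have h4 : ((⌈√N * u⌉₊ : ℕ) : ℝ) ≤ (JJ k ⌈√N * u⌉₊ : ℕ) := by exact_mod_cast h3
          have h5 := Nat.le_ceil (√N * u)
          linarith
        have h6 : sh N (JJ k ⌈√N * u⌉₊) / pb N ≤ C * Real.exp (-(π / 4 * u)) := by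
          rw [div_le_iff₀ hp]
          refine h1.trans ?_
          rw [mul_right_comm]
          gcongr
        calc _ ≤ r * u ^ (r - 1) * (C * Real.exp (-(π / 4 * u))) := by gcongr
          _ = _ := by ring
      · rw [Set.indicator_of_notMem hv]; exact hb
    · exact (dom_int r hr (by positivity : 0 < π / 4)).1.const_mul _
    · rw [ae_restrict_iff' measurableSet_Ioi]
      refine Eventually.of_forall fun u hu => ?_
      have hu0 : (0 : ℝ) < u := hu
      have hJ : Tendsto (fun N : ℕ => ((JJ k ⌈√N * u⌉₊ : ℕ) : ℝ) / √N) atTop (𝓝 ((k + 1) * u)) := by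
        have hc : Tendsto (fun N : ℕ => ((⌈√N * u⌉₊ : ℕ) : ℝ) / √N) atTop (𝓝 u) := by
          have := (tendsto_nat_ceil_mul_div_atTop (R := ℝ) hu0.le).comp hsq
          refine this.congr fun N => ?_
          simp [mul_comm]
        have h1 := (hinv.const_mul ((k + 1).choose 2 : ℝ)).add (hc.const_mul ((k : ℝ) + 1))
        rw [mul_zero, zero_add] at h1
        refine h1.congr fun N => ?_
        unfold JJ; push_cast; ring
      have hl := (sh_lim hJ).const_mul ((r : ℝ) * u ^ (r - 1))
      refine hl.congr' ?_
      filter_upwards [hsq.eventually (eventually_ge_atTop u)] with N hN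
      rw [Set.indicator_of_mem (by exact hN)]
  have e : (∫ u in Set.Ioi (0 : ℝ), r * u ^ (r - 1) * Real.exp (-(π / 2 * ((k + 1) * u)))) =
      r.factorial * (2 / (π * (k + 1))) ^ r := by
    have h1 := (dom_int r hr (by positivity : 0 < π / 2 * ((k : ℝ) + 1))).2
    have : ∀ u : ℝ, r * u ^ (r - 1) * Real.exp (-(π / 2 * ((k + 1) * u))) =
        r * (u ^ (r - 1) * Real.exp (-(π / 2 * ((k : ℝ) + 1) * u))) := by
      intro u; rw [mul_assoc, mul_assoc (π / 2)]
    simp_rw [this]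
    rw [integral_const_mul, h1]
    have h2 : (r.factorial : ℝ) = r * (r - 1).factorial := by
      rw [← Nat.mul_factorial_pred (by omega : r ≠ 0)]; push_cast; ring
    rw [h2, show 1 / (π / 2 * ((k : ℝ) + 1)) = 2 / (π * (k + 1)) by field_simp]
    ring
  rw [e] at key
  refine key.congr' ?_
  filter_upwards [eventually_ge_atTop 1] with N hN
  rw [TT_eq r k N hr hN]

end CrankProof

namespace CrankProof
open Filter Topology MeasureTheory
open scoped Real

lemma eta_one : Tendsto (fun n : ℕ => ∑ k ∈ Finset.range n, (-1 : ℝ) ^ k * (1 / ((k : ℝ) + 1))) atTop (𝓝 (Real.log 2)) := by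
  have hanti : Antitone (fun k : ℕ => 1 / ((k : ℝ) + 1)) := by
    intro a b hab
    have : (a : ℝ) ≤ b := by exact_mod_cast hab
    dsimp only; gcongr
  obtain ⟨l, hl⟩ := hanti.tendsto_alternating_series_of_tendsto_zero tendsto_one_div_add_atTop_nhds_zero_nat
  have h2 : Tendsto (fun n : ℕ => 2 * n) atTop atTop := tendsto_id.const_mul_atTop' (by norm_num)
  have hl2 := hl.comp h2
  have e : ∀ n : ℕ, ∑ k ∈ Finset.range (2 * n), (-1 : ℝ) ^ k * (1 / ((k : ℝ) + 1)) = (harmonic (2 * n) : ℝ) - harmonic n := by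
    intro n
    induction n with
    | zero => simp
    | succ n ih =>
      rw [show 2 * (n + 1) = 2 * n + 1 + 1 by ring, Finset.sum_range_succ, Finset.sum_range_succ, ih,
        harmonic_succ, harmonic_succ, harmonic_succ]
      push_cast
      rw [pow_succ, pow_mul]
      have : (n : ℝ) + 1 ≠ 0 := by positivity
      have : 2 * (n : ℝ) + 1 + 1 ≠ 0 := by positivity
      norm_num
      field_simp
      ring
  have h3 := Real.tendsto_harmonic_sub_log
  have h4 := ((h3.comp h2).sub h3).add_const (Real.log 2)
  rw [sub_self, zero_add] at h4
  have : l = Real.log 2 := by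
    refine tendsto_nhds_unique hl2 (h4.congr' ?_)
    filter_upwards [eventually_ge_atTop 1] with n hn
    have hn0 : (n : ℝ) ≠ 0 := by positivity
    simp only [Function.comp]
    rw [e]
    push_cast
    rw [Real.log_mul (by norm_num) hn0]
    ring
  rw [← this]; exact hl

lemma zeta_re (r : ℕ) (hr : 2 ≤ r) : Summable (fun n : ℕ => 1 / ((n : ℝ) + 1) ^ r) ∧
    (riemannZeta r).re = ∑' n : ℕ, 1 / ((n : ℝ) + 1) ^ r := by
  have hs : Summable (fun n : ℕ => 1 / (n : ℝ) ^ r) := Real.summable_one_div_nat_pow.2 (by omega)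
  have hs1 : Summable (fun n : ℕ => 1 / ((n : ℝ) + 1) ^ r) := by
    have := (summable_nat_add_iff 1).2 hs
    simpa using this
  refine ⟨hs1, ?_⟩
  rw [zeta_nat_eq_tsum_of_gt_one (by omega)]
  have e : ∀ n : ℕ, 1 / (n : ℂ) ^ r = ((1 / (n : ℝ) ^ r : ℝ) : ℂ) := by intro n; push_cast; rfl
  simp_rw [e]
  rw [← Complex.ofReal_tsum, Complex.ofReal_re, hs.tsum_eq_zero_add]
  have : r ≠ 0 := by omega
  simp [this]

lemma eta_lim (r : ℕ) (hr : 1 ≤ r) :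
    Tendsto (fun n : ℕ => ∑ k ∈ Finset.range n, (-1 : ℝ) ^ k * (1 / ((k : ℝ) + 1) ^ r)) atTop
      (𝓝 (dirichletEtaNat r)) ∧ 0 < dirichletEtaNat r := by
  unfold dirichletEtaNat
  by_cases h : r = 1
  · subst h
    simp only [if_true]
    exact ⟨by simpa using eta_one, Real.log_pos (by norm_num)⟩
  · rw [if_neg h]
    have hr2 : 2 ≤ r := by omega
    obtain ⟨hs, hz⟩ := zeta_re r hr2
    have h2 : (2 : ℝ) ^ (1 - (r : ℝ)) = 2 / 2 ^ r := by
      rw [Real.rpow_sub (by norm_num), Real.rpow_one, Real.rpow_natCast]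
    rw [h2, hz]
    set Z := ∑' n : ℕ, 1 / ((n : ℝ) + 1) ^ r with hZ
    have hodd : HasSum (fun i : ℕ => 1 / (((2 * i + 1 : ℕ) : ℝ) + 1) ^ r) (1 / 2 ^ r * Z) := by
      refine (hs.hasSum.mul_left (1 / 2 ^ r)).congr_fun ?_
      intro i
      push_cast
      rw [show 2 * (i : ℝ) + 1 + 1 = 2 * (i + 1) by ring, mul_pow]
      field_simp
    have hev : Summable (fun i : ℕ => 1 / (((2 * i : ℕ) : ℝ) + 1) ^ r) :=
      hs.comp_injective (i := fun i : ℕ => 2 * i) (fun a b h => by simpa using h)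
    have hall := HasSum.even_add_odd (f := fun n : ℕ => 1 / ((n : ℝ) + 1) ^ r) hev.hasSum hodd
    have hE : (∑' i : ℕ, 1 / (((2 * i : ℕ) : ℝ) + 1) ^ r) + 1 / 2 ^ r * Z = Z := hall.unique hs.hasSum
    have halt := HasSum.even_add_odd (f := fun n : ℕ => (-1 : ℝ) ^ n * (1 / ((n : ℝ) + 1) ^ r))
      (m := ∑' i : ℕ, 1 / (((2 * i : ℕ) : ℝ) + 1) ^ r) (m' := -(1 / 2 ^ r * Z))
      (by simpa [pow_mul] using hev.hasSum) (by simpa [pow_mul, pow_succ] using hodd.neg)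
    constructor
    · have := halt.tendsto_sum_nat
      convert this using 2
      linear_combination -hE
    · have hZp : 0 < Z := hs.tsum_pos (fun n => by positivity) 0 (by simp)
      have h4 : (4 : ℝ) ≤ 2 ^ r := by
        calc (4 : ℝ) = 2 ^ 2 := by norm_num
          _ ≤ 2 ^ r := pow_le_pow_right₀ (by norm_num) hr2
      apply mul_pos _ hZp
      rw [sub_pos, div_lt_one (by positivity)]
      linarith

end CrankProof

namespace CrankProof
open Filter Topology MeasureTheory
open scoped Real

noncomputable def UU (K m N : ℕ) : ℝ := ∑ k ∈ Finset.range K, (-1 : ℝ) ^ k * sh N (JJ k m)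

lemma ct_real (m N : ℕ) (hm : 1 ≤ m) :
    (ct m N : ℝ) = sh N m - if m ≤ N then (ct (m + 1) (N - m) : ℝ) else 0 := by
  have h := ct_rec m N hm
  unfold sh
  split_ifs at h ⊢ with h1
  · have : (ct m N : ℝ) + ct (m + 1) (N - m) = pb (N - m) := by exact_mod_cast h
    linarith
  · have : (ct m N : ℝ) = 0 := by exact_mod_cast h
    linarith

lemma JJ_succ (k m : ℕ) : JJ (k + 1) m = m + JJ k (m + 1) := by
  unfold JJ
  rw [Nat.choose_succ_succ' (k + 1) 1, Nat.choose_one_right]; ring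

lemma sh_shift {m N : ℕ} (h : m ≤ N) (j : ℕ) : sh (N - m) j = sh N (m + j) := by
  unfold sh
  have e : N - m - j = N - (m + j) := by omega
  rw [e]
  congr 1
  simp only [eq_iff_iff]; omega

lemma sh_zero {N j : ℕ} (h : N < j) : sh N j = 0 := by unfold sh; rw [if_neg (by omega)]

lemma ct_alt (K : ℕ) : ∀ m N : ℕ, 1 ≤ m → 0 ≤ (-1 : ℝ) ^ K * (ct m N - UU K m N) := by
  induction K with
  | zero => intro m N _; simp [UU]
  | succ K ih =>
    intro m N hm
    have hU : UU (K + 1) m N = sh N m - ∑ k ∈ Finset.range K, (-1 : ℝ) ^ k * sh N (m + JJ k (m + 1)) := by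
      unfold UU
      rw [Finset.sum_range_succ']
      simp only [JJ_succ, pow_succ]
      have : JJ 0 m = m := by simp [JJ]
      rw [this]; simp [Finset.sum_neg_distrib]; ring
    rw [hU, ct_real m N hm]
    by_cases h : m ≤ N
    · rw [if_pos h]
      have := ih (m + 1) (N - m) (by omega)
      unfold UU at this
      simp_rw [sh_shift h] at this
      rw [pow_succ]; linarith
    · rw [if_neg h]
      have : ∀ k, sh N (m + JJ k (m + 1)) = 0 := fun k => sh_zero (by omega)
      simp [this]

noncomputable def Sc (r N : ℕ) : ℝ := ∑ m ∈ Finset.range N, (((m : ℝ) + 1) ^ r - (m : ℝ) ^ r) * ct (m + 1) N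

lemma Sc_alt (r K N : ℕ) : 0 ≤ (-1 : ℝ) ^ K * (Sc r N - ∑ k ∈ Finset.range K, (-1 : ℝ) ^ k * TT r k N) := by
  have e : (-1 : ℝ) ^ K * (Sc r N - ∑ k ∈ Finset.range K, (-1 : ℝ) ^ k * TT r k N) =
      ∑ m ∈ Finset.range N, (((m : ℝ) + 1) ^ r - (m : ℝ) ^ r) * ((-1 : ℝ) ^ K * (ct (m + 1) N - UU K (m + 1) N)) := by
    have h1 : ∑ k ∈ Finset.range K, (-1 : ℝ) ^ k * TT r k N =
        ∑ m ∈ Finset.range N, (((m : ℝ) + 1) ^ r - (m : ℝ) ^ r) * UU K (m + 1) N := by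
      unfold TT UU
      simp_rw [Finset.mul_sum]
      rw [Finset.sum_comm]
      refine Finset.sum_congr rfl fun m _ => Finset.sum_congr rfl fun k _ => ?_
      ring
    rw [h1]
    unfold Sc
    rw [← Finset.sum_sub_distrib, Finset.mul_sum]
    refine Finset.sum_congr rfl fun m _ => ?_
    ring
  rw [e]
  refine Finset.sum_nonneg fun m _ => mul_nonneg ?_ (ct_alt K _ _ (by omega))
  rw [sub_nonneg]
  gcongr; linarith

lemma Sc_lim (r : ℕ) (hr : 1 ≤ r) :
    Tendsto (fun N => Sc r N / (pb N * √N ^ r)) atTop (𝓝 (r.factorial * (2 / π) ^ r * dirichletEtaNat r)) := by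
  set c : ℝ := r.factorial * (2 / π) ^ r with hc
  have hpi := Real.pi_pos
  have hpart : Tendsto (fun K : ℕ => ∑ k ∈ Finset.range K, (-1 : ℝ) ^ k * (r.factorial * (2 / (π * (k + 1))) ^ r)) atTop
      (𝓝 (c * dirichletEtaNat r)) := by
    refine ((eta_lim r hr).1.const_mul c).congr fun K => ?_
    rw [Finset.mul_sum]
    refine Finset.sum_congr rfl fun k _ => ?_
    rw [hc, ← div_div, div_pow (2 / π)]; ring
  have hT : ∀ K : ℕ, Tendsto (fun N : ℕ => (∑ k ∈ Finset.range K, (-1 : ℝ) ^ k * TT r k N) / (pb N * √N ^ r)) atTop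
      (𝓝 (∑ k ∈ Finset.range K, (-1 : ℝ) ^ k * (r.factorial * (2 / (π * (k + 1))) ^ r))) := by
    intro K
    have : ∀ N : ℕ, (∑ k ∈ Finset.range K, (-1 : ℝ) ^ k * TT r k N) / (pb N * √N ^ r) =
        ∑ k ∈ Finset.range K, (-1 : ℝ) ^ k * (TT r k N / (pb N * √N ^ r)) := by
      intro N
      rw [Finset.sum_div]
      exact Finset.sum_congr rfl fun k _ => by ring
    simp_rw [this]
    exact tendsto_finsetSum _ fun k _ => (TT_lim r k hr).const_mul _
  rw [tendsto_order]
  constructor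
  · intro a ha
    obtain ⟨K, hK, hev⟩ := ((hpart.eventually_const_lt ha).and_frequently
      (frequently_atTop.2 fun n => ⟨2 * n, by omega, even_two_mul n⟩ : ∃ᶠ K : ℕ in atTop, Even K)).exists
    filter_upwards [(hT K).eventually_const_lt hK] with N hN
    refine hN.trans_le ?_
    have := Sc_alt r K N
    rw [hev.neg_one_pow, one_mul, sub_nonneg] at this
    gcongr
  · intro a ha
    obtain ⟨K, hK, hev⟩ := ((hpart.eventually_lt_const ha).and_frequently
      (frequently_atTop.2 fun n => ⟨2 * n + 1, by omega, odd_two_mul_add_one n⟩ : ∃ᶠ K : ℕ in atTop, Odd K)).exists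
    filter_upwards [(hT K).eventually_lt_const hK] with N hN
    refine lt_of_le_of_lt ?_ hN
    have := Sc_alt r K N
    rw [hev.neg_one_pow] at this
    gcongr
    linarith

lemma Mplus_bd (r N : ℕ) (hr : 1 ≤ r) (hN : 1 ≤ N) :
    Mplus r N = Sc r N - opc {0} (N - 1) := by
  rw [Mplus_eq r N hr]
  unfold Sc
  have e : ∀ m : ℕ, (ct (m + 1) N : ℝ) = opc (Cr (m + 1)) N + if m = 0 then (opc {0} (N - 1) : ℝ) else 0 := by
    intro m
    unfold ct
    by_cases h : m = 0
    · subst h; simp [hN]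
    · simp [h]
  simp_rw [e, mul_add]
  rw [Finset.sum_add_distrib]
  simp only [mul_ite, mul_zero, Finset.sum_ite_eq', Finset.sum_ite_eq, Finset.mem_range]
  rw [if_pos (by omega)]
  have : r ≠ 0 := by omega
  simp [this]

lemma Mplus_lim (r : ℕ) (hr : 1 ≤ r) :
    Tendsto (fun N => Mplus r N / (pb N * √N ^ r)) atTop (𝓝 (r.factorial * (2 / π) ^ r * dirichletEtaNat r)) := by
  obtain ⟨C, hC, hCb⟩ := sh_bound
  have hsq : Tendsto (fun n : ℕ => √(n : ℝ)) atTop atTop :=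
    Real.tendsto_sqrt_atTop.comp tendsto_natCast_atTop_atTop
  have h0 : Tendsto (fun N : ℕ => (opc {0} (N - 1) : ℝ) / (pb N * √N ^ r)) atTop (𝓝 0) := by
    have h1 : Tendsto (fun N : ℕ => C * (√(N : ℝ) ^ r)⁻¹) atTop (𝓝 0) := by
      have := (tendsto_inv_atTop_zero.comp ((tendsto_pow_atTop (by omega : r ≠ 0)).comp hsq)).const_mul C
      rw [mul_zero] at this
      exact this
    refine squeeze_zero' (Eventually.of_forall fun N => by positivity) ?_ h1
    filter_upwards [eventually_ge_atTop 1] with N hN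
    have hN0 : (0 : ℝ) < N := by exact_mod_cast hN
    have hs : 0 < √(N : ℝ) := Real.sqrt_pos.2 hN0
    have hp : (0 : ℝ) < pb N := by exact_mod_cast pb_pos N
    have h2 := hCb N 1 hN
    have h3 : (opc {0} (N - 1) : ℝ) ≤ sh N 1 := by
      unfold sh; rw [if_pos hN]; exact_mod_cast opc_zero_le (N - 1)
    have h4 : Real.exp (-(π / 4 * ((1 : ℕ) / √N))) ≤ 1 := by
      rw [Real.exp_le_one_iff, neg_nonpos]; have := Real.pi_pos; positivity
    have h5 : (opc {0} (N - 1) : ℝ) ≤ C * pb N := by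
      refine h3.trans (h2.trans ?_)
      exact mul_le_of_le_one_right (by positivity) h4
    rw [div_le_iff₀ (by positivity)]
    refine h5.trans (le_of_eq ?_)
    field_simp
  have h1 := (Sc_lim r hr).sub h0
  rw [sub_zero] at h1
  refine h1.congr' ?_
  filter_upwards [eventually_ge_atTop 1] with N hN
  rw [Mplus_bd r N hr hN, sub_div]

lemma main (r : ℕ) (hr : 1 ≤ r) :
    Filter.Tendsto
      (fun N : ℕ => Mplus r N /
        (((r.factorial : ℝ) * dirichletEtaNat r * Real.pi ^ (-(r : ℝ)) * 2 ^ ((r : ℝ) - 3)) *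
          (N : ℝ) ^ ((r : ℝ) / 2 - 1) * Real.exp (Real.pi * Real.sqrt N)))
      Filter.atTop (nhds 1) := by
  have hpi := Real.pi_pos
  have heta := (eta_lim r hr).2
  set A : ℝ := r.factorial * (2 / π) ^ r * dirichletEtaNat r with hA
  have hA0 : 0 < A := by positivity
  have hg : (r.factorial : ℝ) * dirichletEtaNat r * π ^ (-(r : ℝ)) * 2 ^ ((r : ℝ) - 3) = A / 8 := by
    rw [Real.rpow_neg hpi.le, Real.rpow_natCast, Real.rpow_sub (by norm_num), Real.rpow_natCast, hA, div_pow]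
    norm_num
    field_simp
  rw [hg]
  have h := ((Mplus_lim r hr).mul pb_asymp).mul_const A⁻¹
  rw [mul_one, mul_inv_cancel₀ hA0.ne'] at h
  refine h.congr' ?_
  filter_upwards [eventually_ge_atTop 1] with N hN
  have hN0 : (0 : ℝ) < N := by exact_mod_cast hN
  have hs : 0 < √(N : ℝ) := Real.sqrt_pos.2 hN0
  have hp : (0 : ℝ) < pb N := by exact_mod_cast pb_pos N
  have e1 : (N : ℝ) ^ ((r : ℝ) / 2 - 1) = √N ^ r / N := by
    rw [Real.rpow_sub hN0, Real.rpow_one, Real.sqrt_eq_rpow, ← Real.rpow_natCast, ← Real.rpow_mul hN0.le]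
    congr 2; ring
  rw [e1, Real.exp_neg]
  have := (Real.exp_pos (π * √N)).ne'
  field_simp

end CrankProof

/-- For every integer `r ≥ 1`, as `N → ∞`,
`M̄_r^+(N) ∼ γ_r N^{r/2-1} e^{π√N}` with `γ_r = r! η(r) π^{-r} 2^{r-3}`. -/
theorem positive_crank_moment_asymptotic (r : ℕ) (hr : 1 ≤ r) :
    Filter.Tendsto
      (fun N : ℕ => Mplus r N /
        (((r.factorial : ℝ) * dirichletEtaNat r * Real.pi ^ (-(r : ℝ)) * 2 ^ ((r : ℝ) - 3)) *
          (N : ℝ) ^ ((r : ℝ) / 2 - 1) * Real.exp (Real.pi * Real.sqrt N)))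
      Filter.atTop (nhds 1) := by
  exact CrankProof.main r hr
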